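/- arXiv:1812.04883 — 2 statements merged into one kernel-verified Lean document; each statement's English description precedes it below -/
import Mathlib

section
/- Let U ⊆ ℝⁿ be an open connected neighbourhood of a point a ∈ ℝⁿ and let f : U → ℝ be a real-analytic function, not identically zero, with f(a) = 0 and ∇f(a) = 0. Let P ∈ ℝ[x₁,…,xₙ,y] be an irreducible polynomial such that P(x, f(x)) = 0 for all x ∈ U, and let d = deg P. Then there exist constants C > 0 and ε > 0 such that |∇f(x)| ≥ C·|f(x)|^(1 − 1/S(n,d)) for every x ∈ U with |x − a| < ε and |f(x)| < ε. -/
section ValuedField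

open Polynomial

variable {Γ₀ : Type*} [LinearOrderedCommGroupWithZero Γ₀]

/-- Every element of a valuation ring that is algebraic over an integrally closed subring `B`,
via a polynomial having a unit coefficient, is a fraction over `B` with unit denominator. -/
theorem exists_unit_mul_mem_of_aeval_eq_zero {B E : Type*} [CommRing B] [Field E] [Algebra B E]
    [IsIntegrallyClosedIn B E] (v : Valuation E Γ₀) (hB : ∀ b : B, v (algebraMap B E b) ≤ 1)
    {w : E} (hw : v w ≤ 1) (m : ℕ) (p : B[X]) (hm : p.natDegree ≤ m) (hp : aeval w p = 0)
    (hu : ∃ i, v (algebraMap B E (p.coeff i)) = 1) :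
    ∃ s b : B, v (algebraMap B E s) = 1 ∧ w * algebraMap B E s = algebraMap B E b := by
  induction m generalizing p with
  | zero =>
    obtain ⟨i, hi⟩ := hu
    rw [eq_C_of_natDegree_le_zero hm] at hp hi
    rw [aeval_C] at hp
    rw [coeff_C] at hi
    split_ifs at hi <;> simp [hp] at hi
  | succ m ih =>
    set c := p.coeff (m + 1) with hc
    have hint : IsIntegral B (c • w) := by
      by_cases hd : p.natDegree = m + 1
      · have := isIntegral_leadingCoeff_smul p w hp
        rwa [leadingCoeff, hd] at this
      · rw [hc, coeff_eq_zero_of_natDegree_lt (by omega), zero_smul]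
        exact isIntegral_zero
    obtain ⟨b, hb⟩ := (IsIntegrallyClosedIn.isIntegral_iff (R := B)).1 hint
    by_cases hcv : v (algebraMap B E c) = 1
    · exact ⟨c, b, hcv, by rw [hb, Algebra.smul_def, mul_comm]⟩
    have hcv' : v (algebraMap B E c) < 1 := lt_of_le_of_ne (hB c) hcv
    have hbv : v (algebraMap B E b) < 1 := by
      rw [hb, Algebra.smul_def, map_mul]
      exact mul_lt_one_of_lt_of_le hcv' hw
    refine ih (p - C c * X ^ (m + 1) + C b * X ^ m) ?_ ?_ ?_
    · rw [natDegree_le_iff_coeff_eq_zero]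
      intro N hN
      rcases Nat.lt_or_ge (m + 1) N with h | h
      · simp [coeff_X_pow, coeff_eq_zero_of_natDegree_lt (hm.trans_lt h), h.ne', hN.ne']
      · have : N = m + 1 := by omega
        simp [this, coeff_X_pow, hc]
    · simp only [map_add, map_sub, hp, map_mul, aeval_C, map_pow, aeval_X, hb, Algebra.smul_def]
      ring
    · obtain ⟨i, hi⟩ := hu
      refine ⟨i, ?_⟩
      have hne : i ≠ m + 1 := by rintro rfl; exact hcv hi
      by_cases him : i = m
      · subst him
        simp only [coeff_add, coeff_sub, coeff_C_mul, coeff_X_pow, map_add]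
        simp [Valuation.map_add_eq_of_lt_left, hi, hbv]
      · simpa [coeff_X_pow, hne, him] using hi

variable {F : Type*} [Field F] [Algebra ℝ F] (v : Valuation F Γ₀)

theorem valuation_algebraMap_le_one
    (hc : ∀ c : ℝ, c ≠ 0 → v (algebraMap ℝ F c) = 1)
    (c : ℝ) : v (algebraMap ℝ F c) ≤ 1 := by
  by_cases h : c = 0
  · simp [h]
  · exact (hc c h).le

theorem valuation_natCast
    (hc : ∀ c : ℝ, c ≠ 0 → v (algebraMap ℝ F c) = 1)
    {n : ℕ} (hn : n ≠ 0) : v (n : F) = 1 := by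
  have := hc n (by exact_mod_cast hn)
  rwa [map_natCast] at this

variable {τ : F}

theorem valuation_aeval_le_one
    (hc : ∀ c : ℝ, c ≠ 0 → v (algebraMap ℝ F c) = 1) (hτ : v τ < 1)
    (p : ℝ[X]) : v (aeval τ p) ≤ 1 := by
  rw [aeval_eq_sum_range]
  refine Valuation.map_sum_le v fun i _ => ?_
  rw [Algebra.smul_def, map_mul, map_pow]
  exact mul_le_one' (valuation_algebraMap_le_one v hc _) (pow_le_one' hτ.le _)

theorem valuation_aeval_eq_one
    (hc : ∀ c : ℝ, c ≠ 0 → v (algebraMap ℝ F c) = 1) (hτ : v τ < 1)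
    (q : ℝ[X]) (hq : ¬ X ∣ q) : v (aeval τ q) = 1 := by
  have h0 : q.coeff 0 ≠ 0 := fun h => hq (X_dvd_iff.2 h)
  conv_lhs => rw [← X_mul_divX_add q]
  rw [map_add, map_mul, aeval_X, aeval_C, Valuation.map_add_eq_of_lt_right, hc _ h0]
  rw [hc _ h0, map_mul]
  exact mul_lt_one_of_lt_of_le hτ (valuation_aeval_le_one v hc hτ _)

/-- A nonzero real polynomial evaluated at an infinitesimal is comparable to a monomial. -/
theorem exists_valuation_aeval_eq_pow
    (hc : ∀ c : ℝ, c ≠ 0 → v (algebraMap ℝ F c) = 1) (hτ : v τ < 1)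
    (p : ℝ[X]) (hp : p ≠ 0) :
    ∃ m : ℕ, v (aeval τ p) = v τ ^ m := by
  obtain ⟨q, hq, hq0⟩ := exists_eq_pow_rootMultiplicity_mul_and_not_dvd p hp 0
  rw [C_0, sub_zero] at hq hq0
  refine ⟨p.rootMultiplicity 0, ?_⟩
  conv_lhs => rw [hq]
  rw [map_mul, map_mul, map_pow, aeval_X, map_pow, valuation_aeval_eq_one v hc hτ q hq0, mul_one]

theorem aeval_ne_zero_of_valuation_lt_one
    (hc : ∀ c : ℝ, c ≠ 0 → v (algebraMap ℝ F c) = 1) (hτ0 : τ ≠ 0) (hτ : v τ < 1)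
    (p : ℝ[X]) (hp : p ≠ 0) : aeval τ p ≠ 0 := by
  obtain ⟨m, hm⟩ := exists_valuation_aeval_eq_pow v hc hτ p hp
  rw [← v.ne_zero_iff, hm]
  exact pow_ne_zero _ (v.ne_zero_iff.2 hτ0)

/-- Comparison of two monomials in a polynomial relation `V(τ, z) = 0`. -/
theorem exists_valuation_pow_mul_eq
    (hc : ∀ c : ℝ, c ≠ 0 → v (algebraMap ℝ F c) = 1) (hτ0 : τ ≠ 0) (hτ : v τ < 1)
    (V : ℝ[X][X]) (hV : V ≠ 0) {z : F} (hz : z ≠ 0)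
    (h : V.eval₂ (aeval τ : ℝ[X] →ₐ[ℝ] F).toRingHom z = 0) :
    ∃ q i j : ℕ, 1 ≤ q ∧ q ≤ V.natDegree ∧ v z ^ q * v τ ^ i = v τ ^ j := by
  classical
  have hτv : v τ ≠ 0 := v.ne_zero_iff.2 hτ0
  have hzv : v z ≠ 0 := v.ne_zero_iff.2 hz
  set g : ℕ → F := fun k => aeval τ (V.coeff k) * z ^ k with hg
  have hsum : ∑ k ∈ V.support, g k = 0 := by
    rw [eval₂_eq_sum, Polynomial.sum] at h
    exact h
  have hg0 : ∀ k ∈ V.support, g k ≠ 0 := fun k hk =>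
    mul_ne_zero (aeval_ne_zero_of_valuation_lt_one v hc hτ0 hτ _ (mem_support_iff.1 hk))
      (pow_ne_zero _ hz)
  obtain ⟨k, hk, hmax⟩ := Finset.exists_max_image V.support (fun k => v (g k))
    (nonempty_support_iff.2 hV)
  obtain ⟨l, hl, hkl, hle⟩ : ∃ l ∈ V.support, l ≠ k ∧ v (g l) = v (g k) := by
    by_contra! hcon
    have hlt : v (∑ l ∈ V.support.erase k, g l) < v (g k) := by
      refine Valuation.map_sum_lt v (v.ne_zero_iff.2 (hg0 k hk)) fun l hl => ?_
      rw [Finset.mem_erase] at hl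
      exact lt_of_le_of_ne (hmax l hl.2) (hcon l hl.2 hl.1)
    rw [← Finset.add_sum_erase _ _ hk] at hsum
    rw [eq_neg_of_add_eq_zero_left hsum, v.map_neg] at hlt
    exact lt_irrefl _ hlt
  have key : ∀ a b : ℕ, a ∈ V.support → b ∈ V.support → a < b → v (g a) = v (g b) →
      ∃ q i j : ℕ, 1 ≤ q ∧ q ≤ V.natDegree ∧ v z ^ q * v τ ^ i = v τ ^ j := by
    intro a b ha hb hab he
    obtain ⟨i, hi⟩ := exists_valuation_aeval_eq_pow v hc hτ _ (mem_support_iff.1 ha)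
    obtain ⟨j, hj⟩ := exists_valuation_aeval_eq_pow v hc hτ _ (mem_support_iff.1 hb)
    refine ⟨b - a, j, i, by omega, (Nat.sub_le _ _).trans (le_natDegree_of_mem_supp _ hb), ?_⟩
    simp only [hg, map_mul, map_pow, hi, hj] at he
    have hba : b = (b - a) + a := by omega
    rw [hba, pow_add, ← mul_assoc] at he
    have := mul_right_cancel₀ (pow_ne_zero a hzv) he
    rw [this, mul_comm]
  rcases lt_or_gt_of_ne hkl with h' | h'
  · exact key l k hl hk h' hle
  · exact key k l hk hl h' hle.symm

/-- An infinitesimal root of `V(τ, ·)` satisfies `z ^ S = O(τ)` for `S ≥ deg V`. -/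
theorem valuation_pow_le_of_eval₂_eq_zero
    (hc : ∀ c : ℝ, c ≠ 0 → v (algebraMap ℝ F c) = 1) (hτ0 : τ ≠ 0) (hτ : v τ < 1)
    (V : ℝ[X][X]) (hV : V ≠ 0) {S : ℕ}
    (hS : V.natDegree ≤ S) (hS0 : S ≠ 0) {z : F} (hz : v z < 1)
    (h : V.eval₂ (aeval τ : ℝ[X] →ₐ[ℝ] F).toRingHom z = 0) : v z ^ S ≤ v τ := by
  by_cases hz0 : z = 0
  · simp [hz0, hS0]
  obtain ⟨q, i, j, hq1, hq2, he⟩ := exists_valuation_pow_mul_eq v hc hτ0 hτ V hV hz0 h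
  have hτv : 0 < v τ := zero_lt_iff.2 (v.ne_zero_iff.2 hτ0)
  have hij : i < j := by
    by_contra! hcon
    have h1 : v τ ^ i ≤ v τ ^ j := pow_le_pow_right_of_le_one' hτ.le hcon
    rw [← he] at h1
    have h2 : v z ^ q * v τ ^ i < 1 * v τ ^ i :=
      mul_lt_mul_of_pos_right (pow_lt_one₀ zero_le hz (by omega)) (pow_pos hτv _)
    rw [one_mul] at h2
    exact absurd h1 (not_le.2 h2)
  have h1 : v z ^ q = v τ ^ (j - i) := by
    have hj : j = (j - i) + i := by omega
    rw [hj, pow_add] at he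
    exact mul_right_cancel₀ (pow_pos hτv i).ne' he
  calc v z ^ S ≤ v z ^ q := pow_le_pow_right_of_le_one' hz.le (hq2.trans hS)
    _ = v τ ^ (j - i) := h1
    _ ≤ v τ ^ 1 := pow_le_pow_right_of_le_one' hτ.le (by omega)
    _ = v τ := pow_one _

end ValuedField

section DerivationBound

open Polynomial

variable {Γ₀ : Type*} [LinearOrderedCommGroupWithZero Γ₀]
  {L : Type*} [Field L] [Algebra ℝ L] (v : Valuation L Γ₀)

theorem valuation_intCast_le_one
    (hc : ∀ c : ℝ, c ≠ 0 → v (algebraMap ℝ L c) = 1)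
    (m : ℤ) : v (m : L) ≤ 1 := by
  have := valuation_algebraMap_le_one v hc m
  rwa [map_intCast] at this

/-- The logarithmic derivative of `w` in terms of the derivative of `w ^ e / τ ^ m`. -/
theorem Derivation.apply_pow_mul_zpow (D : Derivation ℝ L L) {τ w : L} (hτ0 : τ ≠ 0)
    (hD : D τ = τ) (hw : w ≠ 0) {e : ℕ} (he : e ≠ 0) (m : ℤ) :
    D (w ^ e * τ ^ (-m)) = w ^ e * τ ^ (-m) * (e * (D w / w) - m) := by
  obtain ⟨e, rfl⟩ := Nat.exists_eq_succ_of_ne_zero he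
  rw [D.leibniz, D.leibniz_pow, D.leibniz_zpow, hD, zpow_sub_one₀ hτ0]
  simp only [smul_eq_mul, nsmul_eq_mul, zsmul_eq_mul, Nat.succ_sub_one]
  push_cast
  field_simp
  rw [Nat.succ_eq_add_one]
  ring

/-- On a discretely valued field, a derivation with `D τ = τ` and bounded denominators does not
increase the valuation. -/
theorem Derivation.valuation_le_of_bound
    (hc : ∀ c : ℝ, c ≠ 0 → v (algebraMap ℝ L c) = 1)
    (hst : ∀ z : L, v z ≤ 1 → ∃ c : ℝ, v (z - algebraMap ℝ L c) < 1)
    (D : Derivation ℝ L L) {τ : L} (hτ0 : τ ≠ 0) (hτ : v τ < 1) (hD : D τ = τ)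
    (E : IntermediateField ℝ L) (hτE : τ ∈ E)
    {e : ℕ} (he : e ≠ 0) (hdisc : ∀ w ∈ E, w ≠ 0 → ∃ m : ℤ, v w ^ e = v τ ^ m)
    {M : ℕ} (hM : ∀ w ∈ E, v w ≤ 1 → v (D w) * v τ ^ M ≤ 1) {w : L} (hw : w ∈ E) :
    v (D w) ≤ v w := by
  have hτv : 0 < v τ := zero_lt_iff.2 (v.ne_zero_iff.2 hτ0)
  -- reduce to units
  have red : ∀ w ∈ E, w ≠ 0 → ∃ u ∈ E, v u = 1 ∧ v (D w) ≤ v w * max (v (D u)) 1 := by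
    intro w hw hw0
    obtain ⟨m, hm⟩ := hdisc w hw hw0
    refine ⟨w ^ e * τ ^ (-m), mul_mem (pow_mem hw _) (zpow_mem hτE _), ?_, ?_⟩
    · rw [map_mul, map_pow, map_zpow₀, hm, ← zpow_add₀ hτv.ne', add_neg_cancel, zpow_zero]
    · have hu : v (w ^ e * τ ^ (-m)) = 1 := by
        rw [map_mul, map_pow, map_zpow₀, hm, ← zpow_add₀ hτv.ne', add_neg_cancel, zpow_zero]
      have h1 := D.apply_pow_mul_zpow hτ0 hD hw0 he m
      set u := w ^ e * τ ^ (-m)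
      have hu0 : u ≠ 0 := by
        rw [← v.ne_zero_iff, hu]; exact one_ne_zero
      have h2 : (e : L) * D w = w * (D u * u⁻¹ + m) := by
        rw [h1]; field_simp; ring
      have h3 := congrArg v h2
      rw [map_mul, map_mul, valuation_natCast v hc he, one_mul] at h3
      rw [h3]
      refine mul_le_mul_right ((v.map_add _ _).trans (max_le_max ?_ ?_)) _
      · rw [map_mul, map_inv₀, hu, inv_one, mul_one]
      · exact valuation_intCast_le_one v hc m
  have desc : ∀ s : ℕ, (∀ w ∈ E, v (D w) ^ e * v τ ^ s ≤ v w ^ e) →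
      ∀ w ∈ E, v (D w) ^ e ≤ v w ^ e := by
    intro s
    induction s with
    | zero => intro h; simpa using h
    | succ s ih =>
      intro h
      refine ih fun w hw => ?_
      by_cases hw0 : w = 0
      · simp [hw0, he]
      obtain ⟨u, huE, hu1, hu⟩ := red w hw hw0
      obtain ⟨c, hcu⟩ := hst u hu1.le
      set h' := u - algebraMap ℝ L c
      have hDu : D u = D h' := by simp [h']
      have h'E : h' ∈ E := sub_mem huE (E.algebraMap_mem c)
      have h1 : v (D u) ^ e * v τ ^ s ≤ 1 := by
        by_cases h0 : h' = 0
        · rw [hDu, h0]; simp [he]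
        · have h2 := h h' h'E
          obtain ⟨m, hm⟩ := hdisc h' h'E h0
          have hm1 : 1 ≤ m := by
            by_contra! hcon
            have h3 : v h' ^ e < 1 := pow_lt_one₀ zero_le hcu he
            rw [hm] at h3
            have h4 : 1 ≤ v τ ^ m := by
              rw [← zpow_zero (v τ)]
              exact (zpow_right_strictAnti₀ hτv hτ).antitone (by omega)
            exact absurd h3 (not_lt.2 h4)
          have h5 : v h' ^ e ≤ v τ := by
            rw [hm]
            conv_rhs => rw [← zpow_one (v τ)]
            exact (zpow_right_strictAnti₀ hτv hτ).antitone hm1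
          have h6 := h2.trans h5
          rw [← hDu, pow_succ, ← mul_assoc] at h6
          exact le_of_mul_le_mul_right (by simpa using h6) hτv
      calc v (D w) ^ e * v τ ^ s ≤ (v w * max (v (D u)) 1) ^ e * v τ ^ s := by gcongr
        _ = v w ^ e * (max (v (D u)) 1 ^ e * v τ ^ s) := by rw [mul_pow, mul_assoc]
        _ ≤ v w ^ e * 1 := by
          gcongr
          rcases max_choice (v (D u)) 1 with h | h
          · rw [h]; exact h1
          · rw [h, one_pow, one_mul]; exact pow_le_one' hτ.le _
        _ = v w ^ e := mul_one _
  have base : ∀ w ∈ E, v (D w) ^ e * v τ ^ (M * e) ≤ v w ^ e := by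
    intro w hw
    by_cases hw0 : w = 0
    · simp [hw0, he]
    obtain ⟨u, huE, hu1, hu⟩ := red w hw hw0
    rw [pow_mul, ← mul_pow]
    refine pow_le_pow_left' ?_ _
    calc v (D w) * v τ ^ M ≤ v w * max (v (D u)) 1 * v τ ^ M := by gcongr
      _ = v w * (max (v (D u)) 1 * v τ ^ M) := mul_assoc _ _ _
      _ ≤ v w * 1 := by
        gcongr
        rcases max_choice (v (D u)) 1 with h | h
        · rw [h]; exact hM u huE hu1.le
        · rw [h, one_mul]; exact pow_le_one' hτ.le _
      _ = v w := mul_one _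
  exact le_of_pow_le_pow_left₀ he zero_le (desc _ base w hw)

end DerivationBound

section DerivationAlgebraic

open Polynomial

variable {Γ₀ : Type*} [LinearOrderedCommGroupWithZero Γ₀]

theorem Valuation.le_one_of_isIntegral {A L : Type*} [CommRing A] [Field L] [Algebra A L]
    (v : Valuation L Γ₀) (hA : ∀ a : A, v (algebraMap A L a) ≤ 1) {w : L} (hw : IsIntegral A w) :
    v w ≤ 1 := by
  by_contra! hlt
  have hpos : 0 < v w := zero_lt_one.trans hlt
  obtain ⟨p, hp, hpw⟩ := hw
  rw [eval₂_eq_sum_range, Finset.sum_range_succ, hp.coeff_natDegree, map_one, one_mul] at hpw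
  have h1 : v (∑ i ∈ Finset.range p.natDegree, algebraMap A L (p.coeff i) * w ^ i) <
      v w ^ p.natDegree := by
    refine Valuation.map_sum_lt v (pow_pos hpos _).ne' fun i hi => ?_
    rw [map_mul, map_pow]
    calc _ ≤ 1 * v w ^ i := by gcongr; exact hA _
      _ < _ := by rw [one_mul]; exact pow_lt_pow_right₀ hlt (Finset.mem_range.1 hi)
  rw [eq_neg_of_add_eq_zero_left hpw, v.map_neg, map_pow] at h1
  exact lt_irrefl _ h1

variable {K L : Type*} [Field K] [Field L] [Algebra ℝ L] [Algebra ℝ[X] K] [IsFractionRing ℝ[X] K]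
  [Algebra K L] [Algebra ℝ[X] L] [IsScalarTower ℝ ℝ[X] L] [IsScalarTower ℝ[X] K L]
  (v : Valuation L Γ₀)

theorem algebraMap_eq_aeval_algebraMap_X (p : ℝ[X]) :
    algebraMap ℝ[X] L p = aeval (algebraMap ℝ[X] L X) p := by
  rw [aeval_algebraMap_apply, aeval_X_left_apply]

theorem algebraMap_polynomial_X_ne_zero (K : Type*) {L : Type*} [Field K] [Field L]
    [Algebra ℝ[X] K] [IsFractionRing ℝ[X] K]
    [Algebra K L] [Algebra ℝ[X] L] [IsScalarTower ℝ[X] K L] :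
    algebraMap ℝ[X] L X ≠ 0 := by
  rw [IsScalarTower.algebraMap_apply ℝ[X] K L]
  simp

/-- Nonzero elements algebraic of degree at most `n` over `ℝ(τ)` have valuation in
`1/n! * ℤ`-powers of `v τ`. -/
theorem exists_valuation_pow_factorial_eq_zpow
    (hc : ∀ c : ℝ, c ≠ 0 → v (algebraMap ℝ L c) = 1) (hτ : v (algebraMap ℝ[X] L X) < 1)
    {w : L} (hw : w ≠ 0)
    (hwK : IsAlgebraic K w) {n : ℕ} (hn : (minpoly K w).natDegree ≤ n) :
    ∃ m : ℤ, v w ^ n.factorial = v (algebraMap ℝ[X] L X) ^ m := by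
  set τ := algebraMap ℝ[X] L X with hτdef
  have hτ0 : τ ≠ 0 := algebraMap_polynomial_X_ne_zero K
  have hτv : v τ ≠ 0 := v.ne_zero_iff.2 hτ0
  set V := IsLocalization.integerNormalization (nonZeroDivisors ℝ[X]) (minpoly K w) with hV
  have hV0 : V ≠ 0 := mt IsFractionRing.integerNormalization_eq_zero_iff.1
    (minpoly.ne_zero hwK.isIntegral)
  have hVdeg : V.natDegree ≤ n := by
    refine le_trans (le_natDegree_of_mem_supp _ ?_) hn
    exact IsLocalization.integerNormalization_support _ _ (natDegree_mem_support_of_nonzero hV0)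
  have hVw : V.eval₂ (aeval τ : ℝ[X] →ₐ[ℝ] L).toRingHom w = 0 := by
    have h1 := IsLocalization.integerNormalization_aeval_eq_zero (nonZeroDivisors ℝ[X])
      (minpoly K w) (minpoly.aeval K w)
    rw [aeval_def] at h1
    have h2 : (aeval τ : ℝ[X] →ₐ[ℝ] L).toRingHom = algebraMap ℝ[X] L :=
      RingHom.ext fun p => (algebraMap_eq_aeval_algebraMap_X p).symm
    rwa [h2]
  obtain ⟨q, i, j, hq1, hq2, he⟩ := exists_valuation_pow_mul_eq v hc hτ0 hτ V hV0 hw hVw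
  obtain ⟨r, hr⟩ := Nat.dvd_factorial hq1 (hq2.trans hVdeg)
  refine ⟨(j - i : ℤ) * r, ?_⟩
  rw [hr, pow_mul, zpow_mul, zpow_natCast, zpow_sub₀ hτv, zpow_natCast, zpow_natCast, ← he]
  rw [mul_div_cancel_right₀ _ (pow_ne_zero _ hτv)]

theorem exists_valuation_mul_pow_le_one
    (hc : ∀ c : ℝ, c ≠ 0 → v (algebraMap ℝ L c) = 1) (hτ : v (algebraMap ℝ[X] L X) < 1)
    [Algebra.IsAlgebraic K L] (x : L) :
    ∃ M : ℕ, v x * v (algebraMap ℝ[X] L X) ^ M ≤ 1 := by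
  have hτv : v (algebraMap ℝ[X] L X) ≠ 0 :=
    v.ne_zero_iff.2 (algebraMap_polynomial_X_ne_zero K)
  by_cases hx : x = 0
  · exact ⟨0, by simp [hx]⟩
  obtain ⟨m, hm⟩ := exists_valuation_pow_factorial_eq_zpow (K := K) v hc hτ hx
    (Algebra.IsAlgebraic.isAlgebraic x) le_rfl
  refine ⟨m.natAbs, ?_⟩
  refine (pow_le_one_iff (Nat.factorial_ne_zero (minpoly K x).natDegree)).1 ?_
  rw [mul_pow, hm, ← pow_mul, ← zpow_natCast, ← zpow_add₀ hτv]
  have h1 : 0 ≤ m + ((m.natAbs * (minpoly K x).natDegree.factorial : ℕ) : ℤ) := by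
    have := Nat.factorial_pos (minpoly K x).natDegree
    have : m.natAbs ≤ m.natAbs * (minpoly K x).natDegree.factorial := Nat.le_mul_of_pos_right _ this
    omega
  obtain ⟨k, hk⟩ := Int.eq_ofNat_of_zero_le h1
  rw [hk, zpow_natCast]
  exact pow_le_one' hτ.le _

theorem Derivation.exists_bound_integralClosure
    (hc : ∀ c : ℝ, c ≠ 0 → v (algebraMap ℝ L c) = 1) (hτ : v (algebraMap ℝ[X] L X) < 1)
    [Algebra.IsAlgebraic K L] (D : Derivation ℝ L L)
    (hD : D (algebraMap ℝ[X] L X) = algebraMap ℝ[X] L X) (E : IntermediateField K L)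
    [FiniteDimensional K E] :
    ∃ M : ℕ, ∀ w ∈ E, v w ≤ 1 → v (D w) * v (algebraMap ℝ[X] L X) ^ M ≤ 1 := by
  set τ := algebraMap ℝ[X] L X with hτdef
  have hA : ∀ p : ℝ[X], v (algebraMap ℝ[X] L p) ≤ 1 := fun p => by
    rw [algebraMap_eq_aeval_algebraMap_X]; exact valuation_aeval_le_one v hc hτ p
  have hDp : ∀ p : ℝ[X], v (D (algebraMap ℝ[X] L p)) ≤ 1 := fun p => by
    rw [algebraMap_eq_aeval_algebraMap_X, D.map_aeval, hD, smul_eq_mul, map_mul]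
    exact mul_le_one' (valuation_aeval_le_one v hc hτ _) hτ.le
  have hT : IsScalarTower ℝ[X] E L := IsScalarTower.of_algebraMap_eq fun p => by
    rw [IsScalarTower.algebraMap_apply ℝ[X] K L, IsScalarTower.algebraMap_apply ℝ[X] K E]
    rfl
  let B := integralClosure ℝ[X] E
  have : CharZero K := charZero_of_injective_algebraMap (IsFractionRing.injective ℝ[X] K)
  have : Module.Finite ℝ[X] B := IsIntegralClosure.finite ℝ[X] K E B
  have hB : ∀ b : B, v ((b : E) : L) ≤ 1 := fun b => by
    refine v.le_one_of_isIntegral hA ?_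
    exact (b.2 : IsIntegral ℝ[X] (b : E)).map (IsScalarTower.toAlgHom ℝ[X] E L)
  choose N hN using fun x : L => exists_valuation_mul_pow_le_one (K := K) v hc hτ x
  obtain ⟨s, hs⟩ := (Module.finite_def (R := ℝ[X]) (M := B)).1 inferInstance
  set M := s.sup fun b => N (D ((b : E) : L)) with hM
  have hBM : ∀ b : B, v (D ((b : E) : L)) * v τ ^ M ≤ 1 := by
    intro b
    have hb : b ∈ Submodule.span ℝ[X] (s : Set B) := hs ▸ Submodule.mem_top
    induction hb using Submodule.span_induction with
    | mem b hb =>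
      refine le_trans ?_ (hN (D ((b : E) : L)))
      refine mul_le_mul_right ?_ _
      exact pow_le_pow_right_of_le_one' hτ.le (Finset.le_sup (f := fun b : B => N (D ((b : E) : L))) hb)
    | zero => simp
    | add x y _ _ hx hy =>
      have : D (((x + y : B) : E) : L) = D ((x : E) : L) + D ((y : E) : L) := by simp
      rw [this]
      rcases le_max_iff.1 (v.map_add (D ((x : E) : L)) (D ((y : E) : L))) with h | h
      · exact (mul_le_mul_left h _).trans hx
      · exact (mul_le_mul_left h _).trans hy
    | smul p x _ hx =>
      have : D (((p • x : B) : E) : L) = algebraMap ℝ[X] L p * D ((x : E) : L) +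
          ((x : E) : L) * D (algebraMap ℝ[X] L p) := by
        have : (((p • x : B) : E) : L) = algebraMap ℝ[X] L p * ((x : E) : L) := by
          rw [IsScalarTower.algebraMap_apply ℝ[X] E L]
          change algebraMap E L (p • (x : E)) = _
          rw [Algebra.smul_def, map_mul]
          rfl
        rw [this, D.leibniz, smul_eq_mul, smul_eq_mul]
      rw [this]
      rcases le_max_iff.1 (v.map_add (algebraMap ℝ[X] L p * D ((x : E) : L))
        (((x : E) : L) * D (algebraMap ℝ[X] L p))) with h | h
      · refine (mul_le_mul_left h _).trans ?_
        rw [map_mul, mul_assoc]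
        exact mul_le_one' (hA p) hx
      · refine (mul_le_mul_left h _).trans ?_
        rw [map_mul]
        exact mul_le_one' (mul_le_one' (hB x) (hDp p)) (pow_le_one' hτ.le _)
  refine ⟨M, fun w hw hw1 => ?_⟩
  have halg : IsAlgebraic ℝ[X] (⟨w, hw⟩ : E) :=
    (IsFractionRing.isAlgebraic_iff ℝ[X] K E).2 (Algebra.IsAlgebraic.isAlgebraic _)
  obtain ⟨p, hp0, hpw⟩ := halg
  let : NormalizedGCDMonoid ℝ[X] := Classical.choice inferInstance
  have : Module.IsTorsionFree ℝ[X] E := by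
    have : Function.Injective (algebraMap ℝ[X] E) := by
      rw [IsScalarTower.algebraMap_eq ℝ[X] K E]
      exact (algebraMap K E).injective.comp (IsFractionRing.injective ℝ[X] K)
    exact Module.isTorsionFree_iff_algebraMap_injective.2 this
  have hprim := aeval_primPart_eq_zero hp0 hpw
  obtain ⟨i, hi⟩ : ∃ i, ¬ X ∣ p.primPart.coeff i := by
    by_contra! hcon
    have := p.isPrimitive_primPart X ((C_dvd_iff_dvd_coeff _ _).2 hcon)
    exact not_isUnit_X this
  obtain ⟨t, b, ht, hb⟩ := exists_unit_mul_mem_of_aeval_eq_zero (B := B)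
    (v.comap (algebraMap E L)) (fun b => hB b) (w := ⟨w, hw⟩) hw1 _
    (p.primPart.map (algebraMap ℝ[X] B)) le_rfl (by rwa [aeval_map_algebraMap]) ⟨i, by
      rw [coeff_map, ← IsScalarTower.algebraMap_apply, Valuation.comap_apply,
        ← IsScalarTower.algebraMap_apply, algebraMap_eq_aeval_algebraMap_X]
      exact valuation_aeval_eq_one v hc hτ _ hi⟩
  have ht1 : v ((t : E) : L) = 1 := ht
  have hb' : w * ((t : E) : L) = ((b : E) : L) := congrArg (algebraMap E L) hb
  have hDb := congrArg D hb'
  rw [D.leibniz, smul_eq_mul, smul_eq_mul, ← eq_sub_iff_add_eq'] at hDb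
  have h1 : v (D w) = v (D ((b : E) : L) - w * D ((t : E) : L)) := by
    rw [← hDb, map_mul, ht1, one_mul]
  rw [h1]
  rcases le_max_iff.1 (v.map_sub (D ((b : E) : L)) (w * D ((t : E) : L))) with h | h
  · exact (mul_le_mul_left h _).trans (hBM b)
  · refine (mul_le_mul_left h _).trans ?_
    rw [map_mul, mul_assoc]
    exact mul_le_one' hw1 (hBM t)

/-- The derivation extending `τ d/dτ` does not increase the valuation. -/
theorem Derivation.valuation_apply_le
    (hc : ∀ c : ℝ, c ≠ 0 → v (algebraMap ℝ L c) = 1) (hτ : v (algebraMap ℝ[X] L X) < 1)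
    [Algebra.IsAlgebraic K L]
    (hst : ∀ z : L, v z ≤ 1 → ∃ c : ℝ, v (z - algebraMap ℝ L c) < 1) (D : Derivation ℝ L L)
    (hD : D (algebraMap ℝ[X] L X) = algebraMap ℝ[X] L X) (z : L) : v (D z) ≤ v z := by
  let E : IntermediateField K L := IntermediateField.adjoin K {z}
  have : FiniteDimensional K E :=
    IntermediateField.adjoin.finiteDimensional (Algebra.IsIntegral.isIntegral z)
  have hXE : ∀ p : ℝ[X], algebraMap ℝ[X] L p ∈ E := fun p => by
    rw [IsScalarTower.algebraMap_apply ℝ[X] K L]; exact E.algebraMap_mem _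
  let E' : IntermediateField ℝ L := E.toSubfield.toIntermediateField fun c => by
    rw [IsScalarTower.algebraMap_apply ℝ ℝ[X] L]; exact hXE _
  obtain ⟨M, hM⟩ := D.exists_bound_integralClosure v hc hτ hD E
  refine D.valuation_le_of_bound v hc hst (algebraMap_polynomial_X_ne_zero K) hτ hD E' (hXE X)
    (Nat.factorial_ne_zero (Module.finrank K E)) (fun w hw hw0 => ?_) (M := M) hM
    (IntermediateField.mem_adjoin_simple_self K z)
  refine exists_valuation_pow_factorial_eq_zpow (K := K) v hc hτ hw0
    (Algebra.IsAlgebraic.isAlgebraic w) ?_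
  have := minpoly.natDegree_le (A := K) (⟨w, hw⟩ : E)
  rwa [← minpoly.algebraMap_eq (algebraMap E L).injective] at this

end DerivationAlgebraic

section ExistsDerivation

open Polynomial

theorem Derivation.exists_apply_X_eq (K : Type*) {L : Type*} [Field K] [Field L] [Algebra ℝ L]
    [Algebra ℝ[X] K] [IsFractionRing ℝ[X] K] [Algebra K L] [Algebra ℝ[X] L]
    [IsScalarTower ℝ ℝ[X] L] [IsScalarTower ℝ[X] K L] [Algebra.IsAlgebraic K L] (y : L) :
    ∃ D : Derivation ℝ L L, D (algebraMap ℝ[X] L X) = y := by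
  have : CharZero K := charZero_of_injective_algebraMap (IsFractionRing.injective ℝ[X] K)
  have : Algebra.FormallyEtale ℝ[X] K :=
    Algebra.FormallyEtale.of_isLocalization (nonZeroDivisors ℝ[X])
  have : Algebra.FormallyEtale K L := Algebra.FormallyEtale.of_isSeparable K L
  have : Algebra.FormallyEtale ℝ[X] L := Algebra.FormallyEtale.comp ℝ[X] K L
  let D₀ : Derivation ℝ ℝ[X] L := Polynomial.mkDerivation ℝ y
  let l : Ω[L⁄ℝ] →ₗ[L] L := (D₀.liftKaehlerDifferential.liftBaseChange L).comp
    (KaehlerDifferential.tensorKaehlerEquivOfFormallyEtale ℝ ℝ[X] L).symm.toLinearMap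
  refine ⟨l.compDer (KaehlerDifferential.D ℝ L), ?_⟩
  change l (KaehlerDifferential.D ℝ L (algebraMap ℝ[X] L X)) = y
  simp only [l, LinearMap.comp_apply, LinearEquiv.coe_coe,
    KaehlerDifferential.tensorKaehlerEquivOfFormallyEtale_symm_D_algebraMap]
  simp [D₀]

end ExistsDerivation

section Abstract

open Polynomial

variable {Γ₀ : Type*} [LinearOrderedCommGroupWithZero Γ₀]

theorem MvPolynomial.derivation_aeval {L : Type*} [CommRing L] [Algebra ℝ L] {σ : Type*} [Fintype σ]
    (D : Derivation ℝ L L) (x : σ → L) (Q : MvPolynomial σ ℝ) :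
    D (MvPolynomial.aeval x Q) =
      ∑ i, MvPolynomial.aeval x (MvPolynomial.pderiv i Q) * D (x i) := by
  classical
  induction Q using MvPolynomial.induction_on with
  | C a => simp
  | add p q hp hq => simp [hp, hq, add_mul, Finset.sum_add_distrib]
  | mul_X p i hp =>
    simp only [map_mul, MvPolynomial.aeval_X, D.leibniz, hp, Derivation.leibniz, map_add,
      smul_eq_mul, MvPolynomial.pderiv_X, add_mul, Finset.sum_add_distrib, Finset.mul_sum]
    congr 1
    · rw [Finset.sum_eq_single i] <;> simp +contextual
    · exact Finset.sum_congr rfl fun j _ => by ring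

theorem false_of_valuation_gradient_lt {F : Type*} [Field F] [Algebra ℝ F] (v : Valuation F Γ₀)
    (hc : ∀ c : ℝ, c ≠ 0 → v (algebraMap ℝ F c) = 1)
    (hst : ∀ z : F, v z ≤ 1 → ∃ c : ℝ, v (z - algebraMap ℝ F c) < 1)
    {τ : F} (hτ0 : τ ≠ 0) (hτ : v τ < 1) {n S : ℕ} (hS : S ≠ 0) (x φ : Fin n → F) (y : F)
    (hx : ∀ i, v (x i) ≤ 1)
    (hV : ∀ i, ∃ V : ℝ[X][X], V ≠ 0 ∧ V.natDegree ≤ S ∧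
      V.eval₂ (aeval τ : ℝ[X] →ₐ[ℝ] F).toRingHom (x i) = 0)
    (hVy : ∃ V : ℝ[X][X], V ≠ 0 ∧ V.eval₂ (aeval τ : ℝ[X] →ₐ[ℝ] F).toRingHom y = 0)
    (hy : v (y / τ - 1) < 1) (hφ : ∀ i, v (φ i) ^ S < v τ ^ (S - 1))
    (Q : MvPolynomial (Fin (n + 1)) ℝ)
    (hQ : MvPolynomial.aeval (Fin.snoc x y : Fin (n + 1) → F) Q = 0)
    (hQy : MvPolynomial.aeval (Fin.snoc x y : Fin (n + 1) → F)
      (MvPolynomial.pderiv (Fin.last n) Q) ≠ 0)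
    (hQφ : ∀ i : Fin n, MvPolynomial.aeval (Fin.snoc x y : Fin (n + 1) → F)
        (MvPolynomial.pderiv i.castSucc Q) +
      MvPolynomial.aeval (Fin.snoc x y : Fin (n + 1) → F)
        (MvPolynomial.pderiv (Fin.last n) Q) * φ i = 0) : False := by
  let := (aeval τ : ℝ[X] →ₐ[ℝ] F).toRingHom.toAlgebra
  have halgmap : ∀ p : ℝ[X], algebraMap ℝ[X] F p = aeval τ p := fun p => rfl
  have hT1 : IsScalarTower ℝ ℝ[X] F := IsScalarTower.of_algebraMap_eq fun c => by
    rw [halgmap, algebraMap_eq, aeval_C]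
  have hinj : Function.Injective (algebraMap ℝ[X] F) := by
    rw [injective_iff_map_eq_zero]
    intro p hp
    by_contra hp0
    exact aeval_ne_zero_of_valuation_lt_one v hc hτ0 hτ p hp0 hp
  have : FaithfulSMul ℝ[X] F := (faithfulSMul_iff_algebraMap_injective _ _).2 hinj
  let K := FractionRing ℝ[X]
  let : Algebra K F := FractionRing.liftAlgebra ℝ[X] F
  have hT2 : IsScalarTower ℝ[X] K F := inferInstance
  let L : IntermediateField K F := algebraicClosure K F
  have : Algebra.IsAlgebraic K L := inferInstance
  have hT3 : IsScalarTower ℝ[X] K L := inferInstance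
  have hT3 : IsScalarTower ℝ[X] L F := IsScalarTower.of_algebraMap_eq fun p => by
    rw [IsScalarTower.algebraMap_apply ℝ[X] K F, IsScalarTower.algebraMap_apply ℝ[X] K L]
    rfl
  have hT0 : IsScalarTower ℝ K F := IsScalarTower.of_algebraMap_eq fun c => by
    rw [IsScalarTower.algebraMap_apply ℝ ℝ[X] K, ← IsScalarTower.algebraMap_apply ℝ[X] K F,
      ← IsScalarTower.algebraMap_apply ℝ ℝ[X] F]
  have hT4 : IsScalarTower ℝ K L := IsScalarTower.of_algebraMap_eq fun c =>
    Subtype.ext (IsScalarTower.algebraMap_apply ℝ K F c)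
  have hT5 : IsScalarTower ℝ ℝ[X] L := IsScalarTower.of_algebraMap_eq fun c => by
    rw [IsScalarTower.algebraMap_apply ℝ K L, IsScalarTower.algebraMap_apply ℝ ℝ[X] K,
      ← IsScalarTower.algebraMap_apply ℝ[X] K L]
  have hT6 : IsScalarTower ℝ L F := IsScalarTower.of_algebraMap_eq fun c => by
    rw [IsScalarTower.algebraMap_apply ℝ K F, IsScalarTower.algebraMap_apply ℝ K L]
    rfl
  have hmem : ∀ (z : F) (V : ℝ[X][X]), V ≠ 0 →
      V.eval₂ (aeval τ : ℝ[X] →ₐ[ℝ] F).toRingHom z = 0 → z ∈ L := by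
    intro z V hV0 hVz
    rw [mem_algebraicClosure_iff, ← IsFractionRing.isAlgebraic_iff ℝ[X] K F]
    exact ⟨V, hV0, hVz⟩
  have hxL : ∀ i, x i ∈ L := fun i => by
    obtain ⟨V, h1, -, h2⟩ := hV i
    exact hmem _ V h1 h2
  have hyL : y ∈ L := by
    obtain ⟨V, h1, h2⟩ := hVy
    exact hmem _ V h1 h2
  set τL : L := algebraMap ℝ[X] L X with hτL
  have hτLF : (τL : F) = τ := by
    change algebraMap L F τL = τ
    rw [hτL, ← IsScalarTower.algebraMap_apply ℝ[X] L F, halgmap, aeval_X]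
  let xL : Fin n → L := fun i => ⟨x i, hxL i⟩
  let yL : L := ⟨y, hyL⟩
  let w : Valuation L Γ₀ := v.comap (algebraMap L F)
  have hw : ∀ z : L, w z = v (z : F) := fun z => rfl
  have hcL : ∀ c : ℝ, algebraMap L F (algebraMap ℝ L c) = algebraMap ℝ F c := fun c =>
    (IsScalarTower.algebraMap_apply ℝ L F c).symm
  obtain ⟨D, hD⟩ := Derivation.exists_apply_X_eq K τL
  have hDle : ∀ z, w (D z) ≤ w z := Derivation.valuation_apply_le (K := K) w
    (fun c hc0 => by rw [Valuation.comap_apply, hcL, hc c hc0])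
    (by rw [← hτL, hw, hτLF]; exact hτ)
    (fun z hz => by
      obtain ⟨c, h⟩ := hst z hz
      refine ⟨c, ?_⟩
      rw [Valuation.comap_apply, map_sub, hcL]
      exact h) D hD
  have hrel := MvPolynomial.derivation_aeval D (Fin.snoc xL yL : Fin (n + 1) → L) Q
  have hcoe : ∀ q : MvPolynomial (Fin (n + 1)) ℝ,
      ((MvPolynomial.aeval (Fin.snoc xL yL : Fin (n + 1) → L) q : L) : F) =
        MvPolynomial.aeval (Fin.snoc x y : Fin (n + 1) → F) q := by
    intro q
    change algebraMap L F _ = _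
    rw [← MvPolynomial.aeval_algebraMap_apply]
    congr 2
    ext i
    refine Fin.lastCases ?_ (fun i => ?_) i
    · simp only [Function.comp_apply, Fin.snoc_last]; rfl
    · simp only [Function.comp_apply, Fin.snoc_castSucc]; rfl
  have hQL : MvPolynomial.aeval (Fin.snoc xL yL : Fin (n + 1) → L) Q = 0 := by
    apply Subtype.ext
    rw [hcoe, hQ]; rfl
  rw [hQL, map_zero, Fin.sum_univ_castSucc] at hrel
  simp only [Fin.snoc_last, Fin.snoc_castSucc] at hrel
  have hrelF := congrArg (algebraMap L F) hrel
  simp only [map_zero, map_add, map_sum, map_mul] at hrelF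
  have hcoe' : ∀ q, algebraMap L F (MvPolynomial.aeval (Fin.snoc xL yL : Fin (n + 1) → L) q) =
    MvPolynomial.aeval (Fin.snoc x y : Fin (n + 1) → F) q := hcoe
  simp only [hcoe'] at hrelF
  have hDy : algebraMap L F (D yL) = ∑ i, φ i * algebraMap L F (D (xL i)) := by
    refine mul_left_cancel₀ hQy ?_
    have h : ∑ i, MvPolynomial.aeval (Fin.snoc x y : Fin (n + 1) → F)
          (MvPolynomial.pderiv (Fin.last n) Q) * (φ i * algebraMap L F (D (xL i))) =
        -∑ i : Fin n, MvPolynomial.aeval (Fin.snoc x y : Fin (n + 1) → F)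
          (MvPolynomial.pderiv i.castSucc Q) * algebraMap L F (D (xL i)) := by
      rw [← Finset.sum_neg_distrib]
      refine Finset.sum_congr rfl fun i _ => ?_
      rw [eq_neg_of_add_eq_zero_left (hQφ i)]
      ring
    rw [Finset.mul_sum, h]
    linear_combination -hrelF
  have hτv : 0 < v τ := zero_lt_iff.2 (v.ne_zero_iff.2 hτ0)
  have hτL0 : τL ≠ 0 := fun h => hτ0 (by rw [← hτLF, h]; rfl)
  -- `D y` has the size of `τ`
  have hvDy : v (algebraMap L F (D yL)) = v τ := by
    have h1 : yL = τL * (1 + (yL / τL - 1)) := by field_simp; ring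
    have h2 : D yL = τL + (yL / τL - 1) * τL + τL * D (yL / τL - 1) := by
      conv_lhs => rw [h1]
      rw [D.leibniz, map_add, Derivation.map_one_eq_zero, hD]
      simp only [smul_eq_mul]
      ring
    have h3 : w (yL / τL - 1) < 1 := by
      rw [hw]
      push_cast
      rw [hτLF]
      exact hy
    have h4 : w ((yL / τL - 1) * τL + τL * D (yL / τL - 1)) < w τL := by
      have h0 : 0 < w τL := by rw [hw, hτLF]; exact hτv
      refine w.map_add_lt ?_ ?_
      · rw [map_mul]; exact mul_lt_of_lt_one_left h0 h3
      · rw [map_mul]; exact mul_lt_of_lt_one_right h0 ((hDle _).trans_lt h3)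
    rw [add_assoc] at h2
    have h5 : w (D yL) = w τL := by rw [h2, w.map_add_eq_of_lt_left h4]
    rw [hw, hw, hτLF] at h5
    exact h5
  -- `D x` is small
  have hDx : ∀ i, v (algebraMap L F (D (xL i))) ^ S ≤ v τ := by
    intro i
    obtain ⟨b, hb⟩ := hst (x i) (hx i)
    obtain ⟨V, hV0, hVS, hVx⟩ := hV i
    have h1 : v (x i - algebraMap ℝ F b) ^ S ≤ v τ := by
      refine valuation_pow_le_of_eval₂_eq_zero v hc hτ0 hτ (V.comp (X + C (C b))) ?_ ?_ hS hb ?_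
      · intro h
        apply hV0
        rcases comp_eq_zero_iff.1 h with h | ⟨-, h⟩
        · exact h
        · have := congrArg natDegree h
          rw [natDegree_X_add_C, natDegree_C] at this
          omega
      · rw [natDegree_comp, natDegree_X_add_C, mul_one]; exact hVS
      · have h2 : eval₂ (aeval τ : ℝ[X] →ₐ[ℝ] F).toRingHom (x i - algebraMap ℝ F b)
            (X + C (C b)) = x i := by
          rw [eval₂_add, eval₂_X, eval₂_C]
          change x i - algebraMap ℝ F b + aeval τ (C b) = x i
          rw [aeval_C, sub_add_cancel]
        rw [eval₂_comp, h2, hVx]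
    refine le_trans (pow_le_pow_left' ?_ S) h1
    have h2 : D (xL i) = D (xL i - algebraMap ℝ L b) := by simp
    have h3 := hDle (xL i - algebraMap ℝ L b)
    rw [← h2] at h3
    rw [Valuation.comap_apply, Valuation.comap_apply, map_sub, hcL] at h3
    exact h3
  have hlt : v (∑ i, φ i * algebraMap L F (D (xL i))) < v τ := by
    refine Valuation.map_sum_lt v hτv.ne' fun i _ => ?_
    refine lt_of_pow_lt_pow_left₀ S zero_le ?_
    rw [map_mul, mul_pow]
    calc v (φ i) ^ S * v (algebraMap L F (D (xL i))) ^ S ≤ v (φ i) ^ S * v τ := by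
          gcongr; exact hDx i
      _ < v τ ^ (S - 1) * v τ := mul_lt_mul_of_pos_right (hφ i) hτv
      _ = v τ ^ S := by rw [← pow_succ, Nat.sub_add_cancel (Nat.pos_of_ne_zero hS)]
  rw [← hDy, hvDy] at hlt
  exact lt_irrefl _ hlt

end Abstract

section HyperrealInstance

open Polynomial Filter Topology

theorem Hyperreal.exists_valuation_of_sequences :
    ∃ (F : Type) (_ : Field F) (_ : Algebra ℝ F) (Γ₀ : Type)
      (_ : LinearOrderedCommGroupWithZero Γ₀) (v : Valuation F Γ₀) (ψ : (ℕ → ℝ) →ₐ[ℝ] F),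
      (∀ c : ℝ, c ≠ 0 → v (algebraMap ℝ F c) = 1) ∧
      (∀ z : F, v z ≤ 1 → ∃ c : ℝ, v (z - algebraMap ℝ F c) < 1) ∧
      (∀ f : ℕ → ℝ, Tendsto f atTop (𝓝 0) → v (ψ f) < 1) ∧
      (∀ (f : ℕ → ℝ) (R : ℝ), (∀ k, |f k| ≤ R) → v (ψ f) ≤ 1) ∧
      (∀ f : ℕ → ℝ, (∀ᶠ k in atTop, f k = 0) → ψ f = 0) ∧
      (∀ f : ℕ → ℝ, (∀ᶠ k in atTop, f k ≠ 0) → ψ f ≠ 0) := by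
  let : Algebra ℝ Hyperreal := (Hyperreal.coeRingHom : ℝ →+* Hyperreal).toAlgebra
  have halg : ∀ c : ℝ, algebraMap ℝ Hyperreal c = Hyperreal.ofReal c := fun c => rfl
  let v := AddValuation.toValuation (ArchimedeanClass.addValuation Hyperreal)
  have hv1 : ∀ z : Hyperreal, v z < 1 ↔ 0 < ArchimedeanClass.mk z := fun z => Iff.rfl
  have hv2 : ∀ z : Hyperreal, v z ≤ 1 ↔ 0 ≤ ArchimedeanClass.mk z := fun z => Iff.rfl
  let ψ : (ℕ → ℝ) →ₐ[ℝ] Hyperreal :=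
    { (Germ.coeRingHom (hyperfilter ℕ : Filter ℕ) : (ℕ → ℝ) →+* Germ (hyperfilter ℕ : Filter ℕ) ℝ)
      with commutes' := fun c => rfl }
  have hψ : ∀ f, ψ f = Hyperreal.ofSeq f := fun f => rfl
  have hle : (hyperfilter ℕ : Filter ℕ) ≤ atTop := by
    rw [← Nat.cofinite_eq_atTop]; exact hyperfilter_le_cofinite
  refine ⟨Hyperreal, inferInstance, inferInstance, _, inferInstance, v, ψ, ?_, ?_, ?_, ?_, ?_, ?_⟩
  · intro c hc
    have h := Hyperreal.archimdeanClassMk_coe hc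
    have h1 : v (algebraMap ℝ Hyperreal c) ≤ 1 := (hv2 _).2 h.ge
    refine le_antisymm h1 (not_lt.1 fun h2 => ?_)
    rw [hv1, halg, h] at h2
    exact lt_irrefl _ h2
  · intro z hz
    exact ⟨_, (hv1 _).2 (ArchimedeanClass.mk_sub_stdPart_pos Hyperreal.coeRingHom ((hv2 _).1 hz))⟩
  · intro f hf
    refine (hv1 _).2 (Hyperreal.archimedeanClassMk_pos_of_tendsto ?_)
    rw [hψ, Hyperreal.tendsto_ofSeq]
    exact hf.mono_left hle
  · intro f R hR
    rw [hv2]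
    refine (Hyperreal.archimedeanClassMk_coe_nonneg R).trans ?_
    refine ArchimedeanClass.mk_le_mk_of_abs ?_
    have hR0 : 0 ≤ R := (abs_nonneg _).trans (hR 0)
    rw [← Hyperreal.coe_abs, abs_of_nonneg hR0, abs_le]
    have e1 : (Hyperreal.ofReal R) = Hyperreal.ofSeq fun _ => R := rfl
    have e2 : -(Hyperreal.ofReal R) = Hyperreal.ofSeq fun _ => -R := rfl
    rw [e2, e1, hψ, Hyperreal.ofSeq_le_ofSeq, Hyperreal.ofSeq_le_ofSeq]
    exact ⟨Eventually.of_forall fun k => (abs_le.1 (hR k)).1,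
      Eventually.of_forall fun k => (abs_le.1 (hR k)).2⟩
  · intro f hf
    exact Germ.coe_eq.2 (hle hf)
  · intro f hf h
    have h1 : ∀ᶠ k in (hyperfilter ℕ : Filter ℕ), f k = 0 := Germ.coe_eq.1 h
    obtain ⟨k, hk1, hk2⟩ := (h1.and (hle hf)).exists
    exact hk2 hk1

theorem map_sequence_eval₂ {F : Type*} [Field F] [Algebra ℝ F] (ψ : (ℕ → ℝ) →ₐ[ℝ] F)
    (V : ℝ[X][X]) (t z : ℕ → ℝ) :
    V.eval₂ (aeval (ψ t) : ℝ[X] →ₐ[ℝ] F).toRingHom (ψ z) =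
      ψ fun k => (V.map (evalRingHom (t k))).eval (z k) := by
  induction V using Polynomial.induction_on' with
  | add p q hp hq =>
    rw [eval₂_add, hp, hq, ← map_add]
    congr 1
    ext k
    simp
  | monomial m a =>
    rw [eval₂_monomial]
    change aeval (ψ t) a * _ = _
    rw [aeval_algHom_apply, ← map_pow, ← map_mul]
    congr 1
    ext k
    have h := aeval_algHom_apply (Pi.evalAlgHom ℝ (fun _ : ℕ => ℝ) k) t a
    simp only [Pi.evalAlgHom_apply, coe_aeval_eq_eval] at h
    simp [← h]

theorem map_sequence_aeval {F : Type*} [Field F] [Algebra ℝ F] (ψ : (ℕ → ℝ) →ₐ[ℝ] F) {n : ℕ}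
    (x : Fin n → ℕ → ℝ) (y : ℕ → ℝ) (Q : MvPolynomial (Fin (n + 1)) ℝ) :
    MvPolynomial.aeval (Fin.snoc (fun i => ψ (x i)) (ψ y) : Fin (n + 1) → F) Q =
      ψ fun k => MvPolynomial.eval (Fin.snoc (fun i => x i k) (y k) : Fin (n + 1) → ℝ) Q := by
  have h1 : (Fin.snoc (fun i => ψ (x i)) (ψ y) : Fin (n + 1) → F) =
      fun j => ψ ((Fin.snoc x y : Fin (n + 1) → ℕ → ℝ) j) := by
    ext j
    refine Fin.lastCases ?_ (fun i => ?_) j <;> simp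
  have h2 : MvPolynomial.aeval (Fin.snoc x y : Fin (n + 1) → ℕ → ℝ) Q =
      fun k => MvPolynomial.eval (Fin.snoc (fun i => x i k) (y k) : Fin (n + 1) → ℝ) Q := by
    ext k
    have h := (MvPolynomial.comp_aeval_apply (f := (Fin.snoc x y : Fin (n + 1) → ℕ → ℝ))
      (Pi.evalAlgHom ℝ (fun _ : ℕ => ℝ) k) Q).symm
    simp only [Pi.evalAlgHom_apply] at h
    rw [← h]
    change MvPolynomial.eval _ Q = _
    congr 2
    ext j
    refine Fin.lastCases ?_ (fun i => ?_) j <;> simp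
  rw [h1, ← h2, MvPolynomial.comp_aeval_apply]

/-- There is no sequence of points on the graph `Q = 0` along which the gradient `φ` is
`o(t ^ ((S - 1) / S))` while every coordinate is algebraic over `ℝ(t)` of degree at most `S`
and `y ~ t`. -/
theorem false_of_sequences {n S : ℕ} (hS : S ≠ 0) (t y : ℕ → ℝ) (x φ : Fin n → ℕ → ℝ)
    (ht0 : ∀ᶠ k in atTop, t k ≠ 0) (ht : Tendsto t atTop (𝓝 0)) (R : ℝ)
    (hx : ∀ i k, |x i k| ≤ R)
    (hV : ∀ i, ∃ V : ℝ[X][X], V ≠ 0 ∧ V.natDegree ≤ S ∧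
      ∀ᶠ k in atTop, (V.map (evalRingHom (t k))).eval (x i k) = 0)
    (hVy : ∃ V : ℝ[X][X], V ≠ 0 ∧
      ∀ᶠ k in atTop, (V.map (evalRingHom (t k))).eval (y k) = 0)
    (hy : Tendsto (fun k => y k / t k) atTop (𝓝 1))
    (hφ : ∀ i, Tendsto (fun k => φ i k ^ S / t k ^ (S - 1)) atTop (𝓝 0))
    (Q : MvPolynomial (Fin (n + 1)) ℝ)
    (hQ : ∀ᶠ k in atTop,
      MvPolynomial.eval (Fin.snoc (fun i => x i k) (y k) : Fin (n + 1) → ℝ) Q = 0)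
    (hQy : ∀ᶠ k in atTop, MvPolynomial.eval (Fin.snoc (fun i => x i k) (y k) : Fin (n + 1) → ℝ)
      (MvPolynomial.pderiv (Fin.last n) Q) ≠ 0)
    (hQφ : ∀ i : Fin n, ∀ᶠ k in atTop,
      MvPolynomial.eval (Fin.snoc (fun i => x i k) (y k) : Fin (n + 1) → ℝ)
        (MvPolynomial.pderiv i.castSucc Q) +
      MvPolynomial.eval (Fin.snoc (fun i => x i k) (y k) : Fin (n + 1) → ℝ)
        (MvPolynomial.pderiv (Fin.last n) Q) * φ i k = 0) : False := by
  obtain ⟨F, _, _, Γ₀, _, v, ψ, hc, hst, hinf, hfin, hzero, hne⟩ :=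
    Hyperreal.exists_valuation_of_sequences
  have hτ0 : ψ t ≠ 0 := hne t ht0
  have hdiv : ∀ (f g : ℕ → ℝ), (∀ᶠ k in atTop, g k ≠ 0) → ψ (fun k => f k / g k) = ψ f / ψ g := by
    intro f g hg
    rw [eq_div_iff (hne g hg), ← map_mul, ← sub_eq_zero, ← map_sub]
    refine hzero _ (hg.mono fun k hk => ?_)
    simp [hk]
  refine false_of_valuation_gradient_lt v hc hst hτ0 (hinf t ht) hS (fun i => ψ (x i))
    (fun i => ψ (φ i)) (ψ y) (fun i => hfin _ R (hx i)) (fun i => ?_) ?_ ?_ (fun i => ?_) Q ?_ ?_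
    (fun i => ?_)
  · obtain ⟨V, h1, h2, h3⟩ := hV i
    exact ⟨V, h1, h2, by rw [map_sequence_eval₂]; exact hzero _ h3⟩
  · obtain ⟨V, h1, h3⟩ := hVy
    exact ⟨V, h1, by rw [map_sequence_eval₂]; exact hzero _ h3⟩
  · rw [← hdiv y t ht0, ← map_one ψ, ← map_sub]
    refine hinf _ ?_
    have h := hy.sub_const 1
    rw [sub_self] at h
    exact h
  · have h1 := hinf _ (hφ i)
    have h2 := hdiv (fun k => φ i k ^ S) (fun k => t k ^ (S - 1)) (ht0.mono fun k => pow_ne_zero _)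
    have e1 : (fun k => φ i k ^ S) = φ i ^ S := rfl
    have e2 : (fun k => t k ^ (S - 1)) = t ^ (S - 1) := rfl
    rw [h2, e1, e2, map_pow, map_pow, map_div₀, map_pow, map_pow] at h1
    exact (div_lt_one₀ (pow_pos (zero_lt_iff.2 (v.ne_zero_iff.2 hτ0)) _)).1 h1
  · rw [map_sequence_aeval]; exact hzero _ hQ
  · rw [map_sequence_aeval]; exact hne _ hQy
  · rw [map_sequence_aeval, map_sequence_aeval, ← map_mul, ← map_add]
    exact hzero _ (hQφ i)

end HyperrealInstance

section DimensionCount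

open Finset

theorem MvPolynomial.card_totalDegree_le (n D : ℕ) :
    Nat.card {e : Fin n →₀ ℕ | (e.sum fun _ k => k) ≤ D} = (n + D).choose n := by
  have h : {e : Fin n →₀ ℕ | (e.sum fun _ k => k) ≤ D} =
      ((range (D + 1)).biUnion fun k => finsuppAntidiag (univ : Finset (Fin n)) k : Finset _) := by
    ext e
    simp [mem_finsuppAntidiag, Finsupp.sum_fintype]
  rw [h, Nat.card_eq_card_toFinset]
  simp only [Finset.toFinset_coe]
  rw [card_biUnion]
  · simp_rw [card_finsuppAntidiag_nat_eq_multichoose, card_univ, Fintype.card_fin]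
    rw [Nat.sum_range_multichoose, add_comm]
  · intro i _ j _ hij
    rw [Function.onFun, disjoint_left]
    intro e he he'
    rw [mem_finsuppAntidiag] at he he'
    exact hij (he.1.symm.trans he'.1)

theorem MvPolynomial.finrank_restrictTotalDegree (n D : ℕ) :
    Module.finrank ℝ (MvPolynomial.restrictTotalDegree (Fin n) ℝ D) = (n + D).choose n := by
  rw [← MvPolynomial.card_totalDegree_le]
  exact Module.finrank_eq_nat_card_basis (MvPolynomial.basisRestrictSupport ℝ _)

theorem MvPolynomial.finite_restrictTotalDegree (n D : ℕ) :
    Module.Finite ℝ (MvPolynomial.restrictTotalDegree (Fin n) ℝ D) := by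
  have : Finite {e : Fin n →₀ ℕ | (e.sum fun _ k => k) ≤ D} := by
    refine Nat.finite_of_card_ne_zero ?_
    rw [MvPolynomial.card_totalDegree_le]
    exact (Nat.choose_pos (by omega)).ne'
  exact Module.Finite.of_basis (MvPolynomial.basisRestrictSupport ℝ _)

theorem Nat.choose_succ_add_le (n N d : ℕ) :
    (N + d).choose (n + 1) ≤ N.choose (n + 1) + d * (N + d - 1).choose n := by
  induction d with
  | zero => simp
  | succ d ih =>
    have h1 : (N + (d + 1)).choose (n + 1) = (N + d).choose n + (N + d).choose (n + 1) :=
      Nat.choose_succ_succ _ _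
    have h2 : (N + d - 1).choose n ≤ (N + d).choose n := Nat.choose_le_choose _ (by omega)
    have h3 : N + (d + 1) - 1 = N + d := by omega
    rw [h1, h3]
    nlinarith [Nat.mul_le_mul_left d h2]

theorem Nat.choose_add_mul_le (n c D : ℕ) (hc : 1 ≤ c) :
    (n + c * D).choose n ≤ c ^ n * (n + D).choose n := by
  induction n with
  | zero => simp
  | succ n ih =>
    have h1 := Nat.add_one_mul_choose_eq (n + c * D) n
    have h2 := Nat.add_one_mul_choose_eq (n + D) n
    have e1 : n + 1 + c * D = n + c * D + 1 := by ring
    have e2 : n + 1 + D = n + D + 1 := by ring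
    rw [e1, e2]
    refine Nat.le_of_mul_le_mul_right ?_ (Nat.succ_pos n)
    rw [← Nat.succ_eq_add_one n] at *
    have h3 : n + c * D + 1 ≤ c * (n + D + 1) := by nlinarith
    calc _ = (n + c * D + 1) * (n + c * D).choose n := by rw [← h1]
      _ ≤ (c * (n + D + 1)) * (c ^ n * (n + D).choose n) := Nat.mul_le_mul h3 ih
      _ = c ^ (n + 1) * ((n + D + 1) * (n + D).choose n) := by ring
      _ = _ := by rw [h2, mul_assoc]

/-- The space of restrictions of polynomials of degree at most `M` to a hypersurface of degree
at most `d` has dimension at most `d * (n + M).choose n`. -/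
theorem MvPolynomial.finrank_map_restrictTotalDegree_le {n d : ℕ} {A : Type*} [CommRing A]
    [Algebra ℝ A] (Φ : MvPolynomial (Fin (n + 1)) ℝ →ₐ[ℝ] A) {Q : MvPolynomial (Fin (n + 1)) ℝ}
    (hQ0 : Q ≠ 0) (hQ : Φ Q = 0) (hd : Q.totalDegree ≤ d) (hd1 : 1 ≤ d) (M : ℕ) :
    Module.finrank ℝ ((restrictTotalDegree (Fin (n + 1)) ℝ M).map Φ.toLinearMap) ≤
      d * (n + M).choose n := by
  have := finite_restrictTotalDegree (n + 1) M
  rcases lt_or_ge M d with hM | hM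
  · refine (Submodule.finrank_map_le _ _).trans ?_
    rw [finrank_restrictTotalDegree]
    have h := Nat.choose_succ_add_le n n (M + 1)
    rw [Nat.choose_succ_self, zero_add] at h
    calc (n + 1 + M).choose (n + 1) = (n + (M + 1)).choose (n + 1) := by congr 1; ring
      _ ≤ _ := h
      _ ≤ _ := Nat.mul_le_mul hM le_rfl
  · let g : restrictTotalDegree (Fin (n + 1)) ℝ M →ₗ[ℝ] A :=
      Φ.toLinearMap.domRestrict (restrictTotalDegree (Fin (n + 1)) ℝ M)
    have hg : (restrictTotalDegree (Fin (n + 1)) ℝ M).map Φ.toLinearMap = LinearMap.range g :=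
      (LinearMap.range_domRestrict _ _).symm
    have hrn := LinearMap.finrank_range_add_finrank_ker g
    rw [finrank_restrictTotalDegree] at hrn
    let m : restrictTotalDegree (Fin (n + 1)) ℝ (M - d) →ₗ[ℝ] LinearMap.ker g :=
      { toFun := fun q => ⟨⟨Q * q.1, by
          have h := (mem_restrictTotalDegree _ _ q.1).1 q.2
          rw [mem_restrictTotalDegree]
          exact (totalDegree_mul _ _).trans (by omega)⟩, by
          change Φ (Q * q.1) = 0
          rw [map_mul, hQ, zero_mul]⟩
        map_add' := fun p q => by ext1; ext1; exact mul_add _ _ _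
        map_smul' := fun c q => by ext1; ext1; exact mul_smul_comm _ _ _ }
    have hm : Function.Injective m := by
      intro p q hpq
      have h : Q * p.1 = Q * q.1 := congrArg (fun z => z.1.1) hpq
      exact Subtype.ext (mul_left_cancel₀ hQ0 h)
    have hk := LinearMap.finrank_le_finrank_of_injective hm
    rw [finrank_restrictTotalDegree] at hk
    have h := Nat.choose_succ_add_le n (n + 1 + (M - d)) d
    rw [show n + 1 + (M - d) + d = n + 1 + M by omega,
      show n + 1 + M - 1 = n + M by omega] at h
    rw [hg]
    omega

end DimensionCount

section Relation

open Finset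

/-- `BoundedBy p a b`: the polynomial `p` has degree at most `a`, and its coefficients have total
degree at most `b`. -/
def Polynomial.BoundedBy {σ : Type*} (p : Polynomial (MvPolynomial σ ℝ)) (a b : ℕ) : Prop :=
  p.natDegree ≤ a ∧ ∀ l, (p.coeff l).totalDegree ≤ b

namespace Polynomial.BoundedBy

variable {σ : Type*} {p q : Polynomial (MvPolynomial σ ℝ)} {a b a' b' : ℕ}

theorem mono (hp : p.BoundedBy a b) (ha : a ≤ a') (hb : b ≤ b') : p.BoundedBy a' b' :=
  ⟨hp.1.trans ha, fun l => (hp.2 l).trans hb⟩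

theorem add (hp : p.BoundedBy a b) (hq : q.BoundedBy a b) : (p + q).BoundedBy a b :=
  ⟨Polynomial.natDegree_add_le_of_degree_le hp.1 hq.1, fun l => by
    rw [Polynomial.coeff_add]
    exact (MvPolynomial.totalDegree_add _ _).trans (max_le (hp.2 l) (hq.2 l))⟩

theorem neg (hp : p.BoundedBy a b) : (-p).BoundedBy a b :=
  ⟨by rw [Polynomial.natDegree_neg]; exact hp.1, fun l => by
    rw [Polynomial.coeff_neg, MvPolynomial.totalDegree_neg]
    exact hp.2 l⟩

theorem sub (hp : p.BoundedBy a b) (hq : q.BoundedBy a b) : (p - q).BoundedBy a b := by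
  rw [sub_eq_add_neg]
  exact hp.add hq.neg

theorem mul (hp : p.BoundedBy a b) (hq : q.BoundedBy a' b') :
    (p * q).BoundedBy (a + a') (b + b') :=
  ⟨Polynomial.natDegree_mul_le_of_le hp.1 hq.1, fun l => by
    rw [Polynomial.coeff_mul]
    refine MvPolynomial.totalDegree_finsetSum_le fun i _ => ?_
    exact (MvPolynomial.totalDegree_mul _ _).trans (add_le_add (hp.2 _) (hq.2 _))⟩

theorem const {r : MvPolynomial σ ℝ} (hr : r.totalDegree ≤ b) :
    (Polynomial.C r).BoundedBy 0 b :=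
  ⟨(Polynomial.natDegree_C _).le, fun l => by
    rw [Polynomial.coeff_C]
    split_ifs
    · exact hr
    · simp⟩

theorem X_pow (i : ℕ) : ((Polynomial.X : Polynomial (MvPolynomial σ ℝ)) ^ i).BoundedBy i 0 :=
  ⟨Polynomial.natDegree_X_pow_le i, fun l => by
    rw [Polynomial.coeff_X_pow]
    split_ifs <;> simp⟩

theorem pow (hp : p.BoundedBy a b) (k : ℕ) : (p ^ k).BoundedBy (k * a) (k * b) := by
  induction k with
  | zero => simpa using const (σ := σ) (r := 1) (b := 0) (by simp)
  | succ k ih =>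
    rw [pow_succ, add_mul, add_mul, one_mul, one_mul]
    exact ih.mul hp

theorem prod {ι : Type*} (s : Finset ι) (p : ι → Polynomial (MvPolynomial σ ℝ)) (a b : ι → ℕ)
    (hp : ∀ i ∈ s, (p i).BoundedBy (a i) (b i)) :
    (∏ i ∈ s, p i).BoundedBy (∑ i ∈ s, a i) (∑ i ∈ s, b i) := by
  classical
  induction s using Finset.induction_on with
  | empty => simpa using const (σ := σ) (r := 1) (b := 0) (by simp)
  | insert i s hi ih =>
    rw [prod_insert hi, sum_insert hi, sum_insert hi]
    exact (hp i (mem_insert_self i s)).mul (ih fun j hj => hp j (mem_insert_of_mem hj))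

end Polynomial.BoundedBy

/-- On a hypersurface, `n` rational functions `Γ i / s` depending polynomially on `t`, the
parameter `t` and a further polynomial `ξ` satisfy a nontrivial relation, of controlled degree
in `ξ`. -/
theorem exists_relation {n d K : ℕ} (Z : Set (Fin (n + 1) → ℝ)) {Q : MvPolynomial (Fin (n + 1)) ℝ}
    (hQ0 : Q ≠ 0) (hQ : ∀ z ∈ Z, MvPolynomial.eval z Q = 0) (hd : Q.totalDegree ≤ d) (hd1 : 1 ≤ d)
    (hK : d * (4 * d + 1) ^ n ≤ K)
    (Γ : Fin n → Polynomial (MvPolynomial (Fin (n + 1)) ℝ)) (hΓ : ∀ i, (Γ i).BoundedBy 4 (4 * d))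
    (s : MvPolynomial (Fin (n + 1)) ℝ) (hs : s.totalDegree ≤ 4 * d)
    (ξ : MvPolynomial (Fin (n + 1)) ℝ) :
    ∃ W : MvPolynomial (Fin n) (Polynomial (Polynomial ℝ)), W ≠ 0 ∧
      (∀ e, (W.coeff e).natDegree ≤ K) ∧
      ∀ z ∈ Z, MvPolynomial.eval z s ≠ 0 → ∀ (t : ℝ) (l : Fin n → ℝ),
        (∀ i, l i * MvPolynomial.eval z s = ((Γ i).map (MvPolynomial.eval z)).eval t) →
        W.eval₂ (Polynomial.eval₂RingHom (Polynomial.evalRingHom t) (MvPolynomial.eval z ξ)) l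
          = 0 := by
  classical
  let Φ : MvPolynomial (Fin (n + 1)) ℝ →ₐ[ℝ] (Z → ℝ) :=
    AlgHom.pi fun z => MvPolynomial.aeval z.1
  have hΦ : ∀ q z, Φ q z = MvPolynomial.eval z.1 q := fun q z => rfl
  have hΦQ : Φ Q = 0 := by ext z; exact hQ z.1 z.2
  let D := ξ.totalDegree * K
  let T := 4 * D * K
  let M := (4 * d + 1) * D
  let V := (MvPolynomial.restrictTotalDegree (Fin (n + 1)) ℝ M).map Φ.toLinearMap
  have hV : Module.finrank ℝ V ≤ d * (n + M).choose n :=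
    MvPolynomial.finrank_map_restrictTotalDegree_le Φ hQ0 hΦQ hd hd1 M
  have := MvPolynomial.finite_restrictTotalDegree (n + 1) M
  have : Module.Finite ℝ V := Module.Finite.map _ _
  have hfinE : Finite {e : Fin n →₀ ℕ | (e.sum fun _ k => k) ≤ D} := by
    refine Nat.finite_of_card_ne_zero ?_
    rw [MvPolynomial.card_totalDegree_le]
    exact (Nat.choose_pos (by omega)).ne'
  have := Fintype.ofFinite {e : Fin n →₀ ℕ | (e.sum fun _ k => k) ≤ D}
  let ι := Fin (T + 1) × {e : Fin n →₀ ℕ | (e.sum fun _ k => k) ≤ D} × Fin (K + 1)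
  let g : ι → Polynomial (MvPolynomial (Fin (n + 1)) ℝ) := fun x =>
    Polynomial.X ^ (x.1 : ℕ) * (∏ j, Γ j ^ (x.2.1.1 j)) *
      Polynomial.C (s ^ (D - ∑ j, x.2.1.1 j) * ξ ^ (x.2.2 : ℕ))
  have hE : ∀ x : ι, ∑ j, x.2.1.1 j ≤ D := by
    intro x
    have h := x.2.1.2
    simpa [Finsupp.sum_fintype] using h
  have hg : ∀ x, (g x).BoundedBy (T + 4 * D) M := by
    intro x
    have h1 := Polynomial.BoundedBy.prod univ (fun j => Γ j ^ (x.2.1.1 j)) _ _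
      fun j _ => (hΓ j).pow (x.2.1.1 j)
    rw [← sum_mul, ← sum_mul] at h1
    have h2 : (s ^ (D - ∑ j, x.2.1.1 j) * ξ ^ (x.2.2 : ℕ)).totalDegree ≤
        (D - ∑ j, x.2.1.1 j) * (4 * d) + D := by
      refine (MvPolynomial.totalDegree_mul _ _).trans (add_le_add ?_ ?_)
      · exact (MvPolynomial.totalDegree_pow _ _).trans (Nat.mul_le_mul le_rfl hs)
      · refine (MvPolynomial.totalDegree_pow _ _).trans ?_
        rw [mul_comm]
        exact Nat.mul_le_mul le_rfl (Nat.lt_succ_iff.1 x.2.2.2)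
    refine (((Polynomial.BoundedBy.X_pow _).mul h1).mul (Polynomial.BoundedBy.const h2)).mono ?_ ?_
    · have := hE x
      have := x.1.2
      omega
    · have h3 : (∑ j, x.2.1.1 j) * (4 * d) + (D - ∑ j, x.2.1.1 j) * (4 * d) = D * (4 * d) := by
        rw [← add_mul, Nat.add_sub_cancel' (hE x)]
      have h4 : M = D * (4 * d) + D := by simp only [M]; ring
      omega
  let v : ι → (Fin (T + 4 * D + 1) → V) := fun x l =>
    ⟨Φ ((g x).coeff l), Submodule.mem_map_of_mem
      ((MvPolynomial.mem_restrictTotalDegree _ _ _).2 ((hg x).2 l))⟩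
  have hdep : ¬ LinearIndependent ℝ v := by
    intro hli
    have h := hli.fintype_card_le_finrank
    rw [Module.finrank_pi_fintype] at h
    simp only [sum_const, card_univ, Fintype.card_fin, smul_eq_mul, ι, Fintype.card_prod] at h
    rw [← Nat.card_eq_fintype_card (α := {e : Fin n →₀ ℕ | (e.sum fun _ k => k) ≤ D}),
      MvPolynomial.card_totalDegree_le] at h
    have h1 := Nat.choose_add_mul_le n (4 * d + 1) D (by omega)
    have hpos : 0 < (n + D).choose n := Nat.choose_pos (by omega)
    have h2 : Module.finrank ℝ V ≤ K * (n + D).choose n := by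
      calc _ ≤ d * (n + M).choose n := hV
        _ ≤ d * ((4 * d + 1) ^ n * (n + D).choose n) := Nat.mul_le_mul le_rfl h1
        _ = d * (4 * d + 1) ^ n * (n + D).choose n := by ring
        _ ≤ _ := Nat.mul_le_mul hK le_rfl
    have h3 := h.trans (Nat.mul_le_mul le_rfl h2)
    have h4 : (T + 1) * (K + 1) ≤ (T + 4 * D + 1) * K := by
      refine Nat.le_of_mul_le_mul_right ?_ hpos
      linarith
    simp only [T] at h4
    nlinarith
  obtain ⟨c, hc, x₀, hx₀⟩ := Fintype.not_linearIndependent_iff.1 hdep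
  let W : MvPolynomial (Fin n) (Polynomial (Polynomial ℝ)) := ∑ x : ι, MvPolynomial.monomial x.2.1.1
    (Polynomial.monomial (x.2.2 : ℕ) (Polynomial.monomial (x.1 : ℕ) (c x)))
  refine ⟨W, ?_, ?_, ?_⟩
  · intro hW
    have h : ((W.coeff x₀.2.1.1).coeff x₀.2.2).coeff x₀.1 = c x₀ := by
      simp only [W, MvPolynomial.coeff_sum, Polynomial.finsetSum_coeff,
        MvPolynomial.coeff_monomial]
      rw [sum_eq_single x₀]
      · simp
      · intro x _ hx
        split_ifs with h1
        · rw [Polynomial.coeff_monomial]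
          split_ifs with h2
          · rw [Polynomial.coeff_monomial]
            split_ifs with h3
            · exact absurd (Prod.ext (Fin.ext h3) (Prod.ext (Subtype.ext h1) (Fin.ext h2))) hx
            · rfl
          · simp
        · simp
      · simp
    rw [hW] at h
    exact hx₀ (by simpa using h.symm)
  · intro e
    simp only [W, MvPolynomial.coeff_sum, MvPolynomial.coeff_monomial]
    refine Polynomial.natDegree_sum_le_of_forall_le _ _ fun x _ => ?_
    split_ifs
    · exact (Polynomial.natDegree_monomial_le _).trans (Nat.lt_succ_iff.1 x.2.2.2)
    · simp
  · intro z hz hsz t l hl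
    have hgz : ∀ x, ((g x).map (MvPolynomial.eval z)).eval t =
        MvPolynomial.eval z s ^ D * (t ^ (x.1 : ℕ) * MvPolynomial.eval z ξ ^ (x.2.2 : ℕ) *
          ∏ j, l j ^ x.2.1.1 j) := by
      intro x
      simp only [g, Polynomial.map_mul, Polynomial.map_pow, Polynomial.map_X, Polynomial.map_C,
        Polynomial.map_prod, Polynomial.eval_mul, Polynomial.eval_pow, Polynomial.eval_X,
        Polynomial.eval_C, Polynomial.eval_prod, ← hl, map_mul, map_pow, mul_pow, prod_mul_distrib,
        prod_pow_eq_pow_sum]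
      rw [show MvPolynomial.eval z s ^ D = MvPolynomial.eval z s ^ (∑ j, x.2.1.1 j) *
        MvPolynomial.eval z s ^ (D - ∑ j, x.2.1.1 j) by
          rw [← pow_add, Nat.add_sub_cancel' (hE x)]]
      ring
    have hzero : ∑ x, c x * ((g x).map (MvPolynomial.eval z)).eval t = 0 := by
      have h1 : ∀ x, ((g x).map (MvPolynomial.eval z)).eval t =
          ∑ m : Fin (T + 4 * D + 1), MvPolynomial.eval z ((g x).coeff m) * t ^ (m : ℕ) := by
        intro x
        rw [Polynomial.eval_eq_sum_range' (n := T + 4 * D + 1), ← Fin.sum_univ_eq_sum_range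
          (fun m => ((g x).map (MvPolynomial.eval z)).coeff m * t ^ m)]
        · simp [Polynomial.coeff_map]
        · exact Nat.lt_succ_iff.2 (Polynomial.natDegree_map_le.trans (hg x).1)
      simp_rw [h1, mul_sum]
      rw [sum_comm]
      refine sum_eq_zero fun m _ => ?_
      have h2 := congrArg (fun w => (w m).1 ⟨z, hz⟩) hc
      simp only [Finset.sum_apply, Pi.smul_apply, v, Submodule.coe_sum, Submodule.coe_smul, hΦ,
        smul_eq_mul, Pi.zero_apply, ZeroMemClass.coe_zero] at h2
      simp_rw [← mul_assoc]
      rw [← sum_mul, h2, zero_mul]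
    simp only [hgz] at hzero
    have h3 : MvPolynomial.eval z s ^ D * W.eval₂ (Polynomial.eval₂RingHom
        (Polynomial.evalRingHom t) (MvPolynomial.eval z ξ)) l = 0 := by
      rw [← hzero]
      simp only [W, MvPolynomial.eval₂_sum, MvPolynomial.eval₂_monomial, mul_sum]
      refine sum_congr rfl fun x _ => ?_
      simp only [Polynomial.coe_eval₂RingHom, Polynomial.eval₂_monomial,
        Polynomial.coe_evalRingHom, Polynomial.eval_monomial]
      rw [Finsupp.prod_fintype _ _ (by simp)]
      ring
    exact (mul_eq_zero.1 h3).resolve_left (pow_ne_zero _ hsz)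

end Relation

section Graph

open Finset MvPolynomial

theorem MvPolynomial.totalDegree_pderiv_le {σ : Type*} (i : σ) (p : MvPolynomial σ ℝ) :
    (pderiv i p).totalDegree ≤ p.totalDegree - 1 := by
  classical
  refine Finset.sup_le fun m hm => ?_
  rw [mem_support_iff, coeff_pderiv] at hm
  have h := le_totalDegree (mem_support_iff.2 (left_ne_zero_of_mul hm))
  rw [Finsupp.sum_add_index' (fun _ => rfl) (fun _ _ _ => rfl), Finsupp.sum_single_index rfl] at h
  omega

theorem MvPolynomial.eq_C_of_pderiv_eq_zero {σ : Type*} (p : MvPolynomial σ ℝ)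
    (hp : ∀ i, pderiv i p = 0) : p = C (p.coeff 0) := by
  classical
  ext m
  rw [coeff_C]
  split_ifs with h
  · rw [h]
  · obtain ⟨i, hi⟩ := Finsupp.ne_iff.1 (Ne.symm h)
    have h1 := congrArg (coeff (m - Finsupp.single i 1)) (hp i)
    rw [coeff_pderiv, coeff_zero, tsub_add_cancel_of_le
      (Finsupp.single_le_iff.2 (Nat.one_le_iff_ne_zero.2 hi))] at h1
    exact (mul_eq_zero.1 h1).resolve_right (by positivity)

theorem MvPolynomial.hasDerivAt_eval {σ : Type*} [Fintype σ] (z : ℝ → σ → ℝ) (z' : σ → ℝ) (τ : ℝ)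
    (hz : ∀ j, HasDerivAt (fun s => z s j) (z' j) τ) (q : MvPolynomial σ ℝ) :
    HasDerivAt (fun s => eval (z s) q) (∑ j, eval (z τ) (pderiv j q) * z' j) τ := by
  classical
  induction q using MvPolynomial.induction_on with
  | C c => simpa using hasDerivAt_const τ c
  | add p q hp hq =>
    simp_rw [map_add, add_mul, sum_add_distrib]
    exact hp.add hq
  | mul_X p j hp =>
    have e : ∑ i, eval (z τ) (pderiv i (p * X j)) * z' i =
        (∑ i, eval (z τ) (pderiv i p) * z' i) * z τ j + eval (z τ) p * z' j := by
      simp only [Derivation.leibniz, smul_eq_mul, pderiv_X, map_add, map_mul, eval_X, add_mul,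
        sum_add_distrib]
      rw [add_comm]
      congr 1
      · rw [sum_mul]
        exact sum_congr rfl fun i _ => by ring
      · rw [sum_eq_single j]
        · simp
        · intro i _ hi
          simp [hi.symm]
        · simp
    rw [e]
    simp_rw [map_mul, eval_X]
    exact hp.mul (hz j)

/-- The point of the graph of `f` above `x`. -/
def graphPoint {n : ℕ} (f : EuclideanSpace ℝ (Fin n) → ℝ) (x : EuclideanSpace ℝ (Fin n)) :
    Fin (n + 1) → ℝ :=
  Fin.snoc (fun i => x i) (f x)

/-- The `i`-th partial derivative. -/
noncomputable def partialDeriv {n : ℕ} (f : EuclideanSpace ℝ (Fin n) → ℝ) (i : Fin n)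
    (x : EuclideanSpace ℝ (Fin n)) : ℝ :=
  fderiv ℝ f x (EuclideanSpace.single i 1)

variable {n : ℕ} {f : EuclideanSpace ℝ (Fin n) → ℝ}

theorem hasDerivAt_line {x : EuclideanSpace ℝ (Fin n)} (hf : DifferentiableAt ℝ f x) (i : Fin n) :
    HasDerivAt (fun s : ℝ => f (x + s • EuclideanSpace.single i (1 : ℝ))) (partialDeriv f i x) 0 :=
  hf.hasFDerivAt.hasLineDerivAt _

theorem gradient_apply_eq_partialDeriv (x : EuclideanSpace ℝ (Fin n)) (i : Fin n) :
    gradient f x i = partialDeriv f i x := by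
  have h : inner ℝ (gradient f x) (EuclideanSpace.single i (1 : ℝ)) = partialDeriv f i x := by
    rw [gradient, InnerProductSpace.toDual_symm_apply, partialDeriv]
  rw [← h, EuclideanSpace.inner_single_right]
  simp

theorem norm_gradient_sq (x : EuclideanSpace ℝ (Fin n)) :
    ‖gradient f x‖ ^ 2 = ∑ i, partialDeriv f i x ^ 2 := by
  simp [EuclideanSpace.norm_sq_eq, gradient_apply_eq_partialDeriv]

theorem hasDerivAt_eval_graphPoint {x : EuclideanSpace ℝ (Fin n)} (hf : DifferentiableAt ℝ f x)
    (i : Fin n) (q : MvPolynomial (Fin (n + 1)) ℝ) :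
    HasDerivAt (fun s : ℝ => eval (graphPoint f (x + s • EuclideanSpace.single i (1 : ℝ))) q)
      (eval (graphPoint f x) (pderiv i.castSucc q) +
        eval (graphPoint f x) (pderiv (Fin.last n) q) * partialDeriv f i x) 0 := by
  have h := hasDerivAt_eval (fun s : ℝ => graphPoint f (x + s • EuclideanSpace.single i (1 : ℝ)))
    (Fin.snoc (Pi.single i 1) (partialDeriv f i x) : Fin (n + 1) → ℝ) 0 (fun j => ?_) q
  · simpa [Fin.sum_univ_castSucc, Pi.single_apply] using h
  · refine Fin.lastCases ?_ (fun j => ?_) j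
    · simpa [graphPoint] using hasDerivAt_line hf i
    · simp only [graphPoint, Fin.snoc_castSucc, PiLp.add_apply, PiLp.smul_apply, smul_eq_mul]
      have h1 := ((hasDerivAt_id (0 : ℝ)).mul_const
        ((EuclideanSpace.single i (1 : ℝ) : EuclideanSpace ℝ (Fin n)) j)).const_add (x j)
      have e : (Pi.single i 1 : Fin n → ℝ) j =
          1 * (EuclideanSpace.single i (1 : ℝ) : EuclideanSpace ℝ (Fin n)) j := by simp [Pi.single_apply]
      rw [e]
      exact h1

variable {U : Set (EuclideanSpace ℝ (Fin n))}

theorem eventually_line_mem (hU : IsOpen U) {x : EuclideanSpace ℝ (Fin n)} (hx : x ∈ U)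
    (v : EuclideanSpace ℝ (Fin n)) : ∀ᶠ s : ℝ in nhds 0, x + s • v ∈ U := by
  have h : Continuous fun s : ℝ => x + s • v := by fun_prop
  exact h.continuousAt.eventually_mem (by simpa using hU.mem_nhds hx)

theorem pderiv_add_pderiv_mul_eq_zero (hU : IsOpen U) (hf : AnalyticOnNhd ℝ f U)
    {q : MvPolynomial (Fin (n + 1)) ℝ} (hq : ∀ x ∈ U, eval (graphPoint f x) q = 0)
    {x : EuclideanSpace ℝ (Fin n)} (hx : x ∈ U) (i : Fin n) :
    eval (graphPoint f x) (pderiv i.castSucc q) +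
      eval (graphPoint f x) (pderiv (Fin.last n) q) * partialDeriv f i x = 0 := by
  have h := hasDerivAt_eval_graphPoint (hf x hx).differentiableAt i q
  refine h.unique ((hasDerivAt_const (0 : ℝ) (0 : ℝ)).congr_of_eventuallyEq ?_)
  filter_upwards [eventually_line_mem hU hx (EuclideanSpace.single i (1 : ℝ))] with s hs
  exact hq _ hs

theorem exists_polynomial_pderiv_ne_zero (hU : IsOpen U) (hne : U.Nonempty)
    (hf : AnalyticOnNhd ℝ f U) (P : MvPolynomial (Fin (n + 1)) ℝ) (hP : P ≠ 0)
    (hPf : ∀ x ∈ U, eval (graphPoint f x) P = 0) :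
    ∃ Q : MvPolynomial (Fin (n + 1)) ℝ, Q ≠ 0 ∧ Q.totalDegree ≤ P.totalDegree ∧
      (∀ x ∈ U, eval (graphPoint f x) Q = 0) ∧
      ∃ x ∈ U, eval (graphPoint f x) (pderiv (Fin.last n) Q) ≠ 0 := by
  induction hN : P.totalDegree using Nat.strong_induction_on generalizing P with
  | _ N ih =>
  by_cases hy : ∃ x ∈ U, eval (graphPoint f x) (pderiv (Fin.last n) P) ≠ 0
  · exact ⟨P, hP, hN.le, hPf, hy⟩
  push Not at hy
  have hall : ∀ j, ∀ x ∈ U, eval (graphPoint f x) (pderiv j P) = 0 := by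
    intro j x hx
    refine Fin.lastCases (hy x hx) (fun i => ?_) j
    have h := pderiv_add_pderiv_mul_eq_zero hU hf hPf hx i
    rwa [hy x hx, zero_mul, add_zero] at h
  obtain ⟨x₀, hx₀⟩ := hne
  have hpos : P.totalDegree ≠ 0 := by
    intro h0
    rw [totalDegree_eq_zero_iff_eq_C] at h0
    have h1 := hPf x₀ hx₀
    rw [h0, eval_C] at h1
    rw [h1, map_zero] at h0
    exact hP h0
  obtain ⟨j, hj⟩ : ∃ j, pderiv j P ≠ 0 := by
    by_contra! h0
    have h1 := eq_C_of_pderiv_eq_zero P h0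
    rw [h1, totalDegree_C] at hpos
    exact hpos rfl
  have hlt : (pderiv j P).totalDegree < N := by
    have := totalDegree_pderiv_le j P
    omega
  obtain ⟨Q, h1, h2, h3, h4⟩ := ih _ hlt _ hj (hall j) rfl
  exact ⟨Q, h1, h2.trans hlt.le, h3, h4⟩

theorem two_le_totalDegree (hU : IsOpen U) (hconn : IsPreconnected U)
    {a : EuclideanSpace ℝ (Fin n)} (ha : a ∈ U) (hf : AnalyticOnNhd ℝ f U)
    (hfne : ∃ x ∈ U, f x ≠ 0) (hfa : f a = 0) (hgrad : ∀ i, partialDeriv f i a = 0)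
    (P : MvPolynomial (Fin (n + 1)) ℝ) (hP : P ≠ 0)
    (hPf : ∀ x ∈ U, eval (graphPoint f x) P = 0) : 2 ≤ P.totalDegree := by
  by_contra! hd
  have hconst : ∀ j, pderiv j P = C ((pderiv j P).coeff 0) := fun j => by
    rw [← totalDegree_eq_zero_iff_eq_C]
    have := totalDegree_pderiv_le j P
    omega
  have hi : ∀ i : Fin n, pderiv i.castSucc P = 0 := by
    intro i
    have h := pderiv_add_pderiv_mul_eq_zero hU hf hPf ha i
    rw [hgrad, mul_zero, add_zero, hconst, eval_C] at h
    rw [hconst, h, map_zero]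
  by_cases hy : pderiv (Fin.last n) P = 0
  · have h := eq_C_of_pderiv_eq_zero P fun j => Fin.lastCases hy hi j
    have h1 := hPf a ha
    rw [h, eval_C] at h1
    rw [h1, map_zero] at h
    exact hP h
  · have hc : (pderiv (Fin.last n) P).coeff 0 ≠ 0 := by
      intro h
      rw [hconst, h, map_zero] at hy
      exact hy rfl
    have hp : ∀ i, ∀ x ∈ U, partialDeriv f i x = 0 := by
      intro i x hx
      have h := pderiv_add_pderiv_mul_eq_zero hU hf hPf hx i
      rw [hi, map_zero, zero_add, hconst, eval_C] at h
      exact (mul_eq_zero.1 h).resolve_left hc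
    have hfd : U.EqOn (fderiv ℝ f) 0 := by
      intro x hx
      have h : gradient f x = 0 := by
        ext i
        rw [gradient_apply_eq_partialDeriv, hp i x hx]
        rfl
      exact (map_eq_zero_iff _ (InnerProductSpace.toDual ℝ _).symm.injective).1 h
    obtain ⟨x, hx, hfx⟩ := hfne
    exact hfx ((hU.is_const_of_fderiv_eq_zero hconn
      (fun x hx => (hf x hx).differentiableAt.differentiableWithinAt) hfd hx ha).trans hfa)

end Graph

section Perturbation

open Finset MvPolynomial

variable {n : ℕ}

/-- The derivation `(∂Q/∂y) ∂ᵢ - (∂Q/∂xᵢ) ∂_y`, tangent to the level sets of `Q`. -/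
noncomputable def tangentDeriv (Q : MvPolynomial (Fin (n + 1)) ℝ) (i : Fin n)
    (q : MvPolynomial (Fin (n + 1)) ℝ) : MvPolynomial (Fin (n + 1)) ℝ :=
  pderiv i.castSucc q * pderiv (Fin.last n) Q - pderiv (Fin.last n) q * pderiv i.castSucc Q

/-- The sum of the squares of the partial derivatives of `Q` in the first `n` variables. -/
noncomputable def horizontalSq (Q : MvPolynomial (Fin (n + 1)) ℝ) : MvPolynomial (Fin (n + 1)) ℝ :=
  ∑ i : Fin n, pderiv i.castSucc Q ^ 2

/-- The polynomial `r² - |x - a|²`. -/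
noncomputable def ballPolynomial (a : EuclideanSpace ℝ (Fin n)) (r : ℝ) :
    MvPolynomial (Fin (n + 1)) ℝ :=
  C (r ^ 2) - ∑ i : Fin n, (X i.castSucc - C (a i)) ^ 2

/-- The numerator, up to a power of `∂Q/∂y`, of `∂ᵢ |∇f|²` on the graph `Q = 0` of `f`. -/
noncomputable def gradSqNumerator (Q : MvPolynomial (Fin (n + 1)) ℝ) (i : Fin n) :
    MvPolynomial (Fin (n + 1)) ℝ :=
  pderiv (Fin.last n) Q * tangentDeriv Q i (horizontalSq Q) -
    C 2 * (horizontalSq Q * tangentDeriv Q i (pderiv (Fin.last n) Q))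

/-- The numerator of the `i`-th partial derivative of `perturbation`, as a polynomial in `t`. -/
noncomputable def perturbationNumerator (Q : MvPolynomial (Fin (n + 1)) ℝ)
    (a : EuclideanSpace ℝ (Fin n)) (r : ℝ) (i : Fin n) :
    Polynomial (MvPolynomial (Fin (n + 1)) ℝ) :=
  Polynomial.C (ballPolynomial a r) *
      (Polynomial.X ^ 2 * Polynomial.C (gradSqNumerator Q i) -
        Polynomial.C (C 2 * (pderiv i.castSucc Q * pderiv (Fin.last n) Q ^ 3)) *
          (Polynomial.C (X (Fin.last n)) - Polynomial.X ^ 1)) +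
    Polynomial.C (C 2 * ((X i.castSucc - C (a i)) * pderiv (Fin.last n) Q ^ 2)) *
      (Polynomial.X ^ 2 * Polynomial.C (horizontalSq Q) +
        Polynomial.C (pderiv (Fin.last n) Q ^ 2) *
          ((Polynomial.C (X (Fin.last n)) - Polynomial.X ^ 1) ^ 2 + Polynomial.X ^ 4))

/-- The function `(t² |∇f|² + (f - t)² + t⁴) / (r² - |x - a|²)`. -/
noncomputable def perturbation (f : EuclideanSpace ℝ (Fin n) → ℝ) (a : EuclideanSpace ℝ (Fin n))
    (r t : ℝ) (x : EuclideanSpace ℝ (Fin n)) : ℝ :=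
  (t ^ 2 * ∑ j, partialDeriv f j x ^ 2 + (f x - t) ^ 2 + t ^ 4) /
    (r ^ 2 - ∑ j, (x j - a j) ^ 2)

theorem totalDegree_sub_le_max {σ : Type*} (p q : MvPolynomial σ ℝ) {b : ℕ}
    (hp : p.totalDegree ≤ b) (hq : q.totalDegree ≤ b) : (p - q).totalDegree ≤ b :=
  (totalDegree_sub _ _).trans (max_le hp hq)

theorem totalDegree_mul_le_add {σ : Type*} {p q : MvPolynomial σ ℝ} {b c m : ℕ}
    (hp : p.totalDegree ≤ b) (hq : q.totalDegree ≤ c) (hm : b + c ≤ m) :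
    (p * q).totalDegree ≤ m :=
  (totalDegree_mul _ _).trans ((add_le_add hp hq).trans hm)

theorem totalDegree_pow_le_mul {σ : Type*} {p : MvPolynomial σ ℝ} {b : ℕ}
    (hp : p.totalDegree ≤ b) (k : ℕ) : (p ^ k).totalDegree ≤ k * b :=
  (totalDegree_pow _ _).trans (Nat.mul_le_mul le_rfl hp)

theorem totalDegree_ballPolynomial_le (a : EuclideanSpace ℝ (Fin n)) (r : ℝ) :
    (ballPolynomial a r).totalDegree ≤ 2 := by
  refine totalDegree_sub_le_max _ _ ((totalDegree_C _).le.trans (by omega))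
    (totalDegree_finsetSum_le fun i _ => ?_)
  exact totalDegree_pow_le_mul (totalDegree_sub_le_max _ _ (totalDegree_X _).le (by simp)) 2

variable {Q : MvPolynomial (Fin (n + 1)) ℝ} {e : ℕ}

theorem totalDegree_tangentDeriv_le (hQ : Q.totalDegree ≤ e + 1) (i : Fin n)
    {q : MvPolynomial (Fin (n + 1)) ℝ} {b : ℕ} (hq : q.totalDegree ≤ b) :
    (tangentDeriv Q i q).totalDegree ≤ b + e := by
  have h1 : ∀ j, (pderiv j Q).totalDegree ≤ e := fun j => by
    have := totalDegree_pderiv_le j Q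
    omega
  have h2 : ∀ j, (pderiv j q).totalDegree ≤ b := fun j =>
    (totalDegree_pderiv_le j q).trans ((Nat.sub_le _ _).trans hq)
  exact totalDegree_sub_le_max _ _ (totalDegree_mul_le_add (h2 _) (h1 _) le_rfl)
    (totalDegree_mul_le_add (h2 _) (h1 _) le_rfl)

theorem boundedBy_perturbationNumerator (hQ : Q.totalDegree ≤ e + 1)
    (a : EuclideanSpace ℝ (Fin n)) (r : ℝ) (i : Fin n) :
    (perturbationNumerator Q a r i).BoundedBy 4 (4 * (e + 1)) := by
  have h1 : ∀ j, (pderiv j Q).totalDegree ≤ e := fun j => by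
    have := totalDegree_pderiv_le j Q
    omega
  have h2 : (horizontalSq Q).totalDegree ≤ 2 * e :=
    totalDegree_finsetSum_le fun i _ => totalDegree_pow_le_mul (h1 _) 2
  have hC : ∀ c : ℝ, (C c : MvPolynomial (Fin (n + 1)) ℝ).totalDegree ≤ 0 := fun c => by simp
  have h3 : (gradSqNumerator Q i).totalDegree ≤ 4 * e :=
    totalDegree_sub_le_max _ _
      (totalDegree_mul_le_add (h1 _) (totalDegree_tangentDeriv_le hQ i h2) (by omega))
      (totalDegree_mul_le_add (hC 2) (totalDegree_mul_le_add h2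
        (totalDegree_tangentDeriv_le hQ i (h1 _)) le_rfl) (by omega))
  have h4 : (X i.castSucc - C (a i) : MvPolynomial (Fin (n + 1)) ℝ).totalDegree ≤ 1 :=
    totalDegree_sub_le_max _ _ (totalDegree_X _).le (by simp)
  have h5 : ((Polynomial.C (X (Fin.last n)) - Polynomial.X ^ 1) :
      Polynomial (MvPolynomial (Fin (n + 1)) ℝ)).BoundedBy 1 1 :=
    ((Polynomial.BoundedBy.const (totalDegree_X _).le).mono (by omega) le_rfl).sub
      ((Polynomial.BoundedBy.X_pow 1).mono le_rfl (by omega))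
  refine Polynomial.BoundedBy.add ?_ ?_
  · refine ((Polynomial.BoundedBy.const (totalDegree_ballPolynomial_le a r)).mul
      (Polynomial.BoundedBy.sub (a := 2) (b := 4 * e + 1) ?_ ?_)).mono (by omega) (by omega)
    · exact ((Polynomial.BoundedBy.X_pow 2).mul (Polynomial.BoundedBy.const h3)).mono
        (by omega) (by omega)
    · exact ((Polynomial.BoundedBy.const (totalDegree_mul_le_add (hC 2) (totalDegree_mul_le_add
        (h1 _) (totalDegree_pow_le_mul (h1 _) 3) le_rfl) le_rfl)).mul h5).mono
        (by omega) (by omega)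
  · refine ((Polynomial.BoundedBy.const (totalDegree_mul_le_add (hC 2) (totalDegree_mul_le_add
      h4 (totalDegree_pow_le_mul (h1 _) 2) le_rfl) le_rfl)).mul
      (Polynomial.BoundedBy.add (a := 4) (b := 2 * e + 2) ?_ ?_)).mono (by omega) (by omega)
    · exact ((Polynomial.BoundedBy.X_pow 2).mul (Polynomial.BoundedBy.const h2)).mono
        (by omega) (by omega)
    · refine ((Polynomial.BoundedBy.const (totalDegree_pow_le_mul (h1 _) 2)).mul
        (Polynomial.BoundedBy.add (a := 4) (b := 2) ?_ ?_)).mono (by omega) (by omega)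
      · exact (h5.pow 2).mono (by omega) (by omega)
      · exact (Polynomial.BoundedBy.X_pow 4).mono le_rfl (by omega)

variable {f : EuclideanSpace ℝ (Fin n) → ℝ} {U : Set (EuclideanSpace ℝ (Fin n))}

theorem analyticOnNhd_partialDeriv (hf : AnalyticOnNhd ℝ f U) (i : Fin n) :
    AnalyticOnNhd ℝ (partialDeriv f i) U := fun x hx =>
  ((ContinuousLinearMap.apply ℝ ℝ (EuclideanSpace.single i (1 : ℝ))).analyticAt _).comp
    (hf.fderiv x hx)

theorem analyticOnNhd_coord (i : Fin n) :
    AnalyticOnNhd ℝ (fun x : EuclideanSpace ℝ (Fin n) => x i) U := fun x _ =>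
  (EuclideanSpace.proj (𝕜 := ℝ) i).analyticAt x

theorem analyticOnNhd_sum_partialDeriv_sq (hf : AnalyticOnNhd ℝ f U) :
    AnalyticOnNhd ℝ (fun x => ∑ j, partialDeriv f j x ^ 2) U :=
  Finset.analyticOnNhd_fun_sum _ fun j _ => (analyticOnNhd_partialDeriv hf j).pow 2

theorem analyticOnNhd_perturbation (hf : AnalyticOnNhd ℝ f U) (a : EuclideanSpace ℝ (Fin n))
    (r t : ℝ) (hU : ∀ x ∈ U, r ^ 2 - ∑ j, (x j - a j) ^ 2 ≠ 0) :
    AnalyticOnNhd ℝ (perturbation f a r t) U := by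
  refine AnalyticOnNhd.div ?_ ?_ hU
  · exact ((analyticOnNhd_const.mul (analyticOnNhd_sum_partialDeriv_sq hf)).add
      ((hf.sub analyticOnNhd_const).pow 2)).add analyticOnNhd_const
  · exact analyticOnNhd_const.sub (Finset.analyticOnNhd_fun_sum _ fun j _ =>
      ((analyticOnNhd_coord j).sub analyticOnNhd_const).pow 2)

theorem eval_ballPolynomial (a : EuclideanSpace ℝ (Fin n)) (r : ℝ) (x : EuclideanSpace ℝ (Fin n)) :
    eval (graphPoint f x) (ballPolynomial a r) = r ^ 2 - ∑ j, (x j - a j) ^ 2 := by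
  simp [ballPolynomial, graphPoint]

theorem partialDeriv_perturbation_mul (hU : IsOpen U) (hf : AnalyticOnNhd ℝ f U)
    (hQ : ∀ x ∈ U, eval (graphPoint f x) Q = 0) (a : EuclideanSpace ℝ (Fin n)) (r t : ℝ)
    {x : EuclideanSpace ℝ (Fin n)} (hx : x ∈ U) (hw : r ^ 2 - ∑ j, (x j - a j) ^ 2 ≠ 0)
    (i : Fin n) :
    partialDeriv (perturbation f a r t) i x *
        eval (graphPoint f x) (ballPolynomial a r ^ 2 * pderiv (Fin.last n) Q ^ 4) =
      ((perturbationNumerator Q a r i).map (eval (graphPoint f x))).eval t := by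
  have hfx := (hf x hx).differentiableAt
  set G : EuclideanSpace ℝ (Fin n) → ℝ := fun x => ∑ j, partialDeriv f j x ^ 2 with hG
  have hGx : DifferentiableAt ℝ G x := (analyticOnNhd_sum_partialDeriv_sq hf x hx).differentiableAt
  set Py := pderiv (Fin.last n) Q with hPy
  have hGQ : ∀ x ∈ U, eval (graphPoint f x) Py ^ 2 * G x = eval (graphPoint f x) (horizontalSq Q) := by
    intro x hx
    rw [horizontalSq, map_sum, hG, mul_sum]
    refine sum_congr rfl fun j _ => ?_
    have h := pderiv_add_pderiv_mul_eq_zero hU hf hQ hx j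
    rw [map_pow, eq_neg_of_add_eq_zero_left h]
    ring
  have e1 := pderiv_add_pderiv_mul_eq_zero hU hf hQ hx i
  have e2 := hGQ x hx
  set v : EuclideanSpace ℝ (Fin n) := EuclideanSpace.single i (1 : ℝ) with hv
  have d1 := hasDerivAt_line hGx i
  have d2 := hasDerivAt_eval_graphPoint hfx i Py
  have d3 := hasDerivAt_eval_graphPoint hfx i (horizontalSq Q)
  have d4 := hasDerivAt_line hfx i
  have e3 := ((d2.fun_pow 2).fun_mul d1).unique (d3.congr_of_eventuallyEq (by
    filter_upwards [eventually_line_mem hU hx v] with s hs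
    exact hGQ _ hs))
  have d5 : HasDerivAt (fun s : ℝ => r ^ 2 - ∑ j, ((x + s • v) j - a j) ^ 2)
      (-(2 * (x i - a i))) 0 := by
    have h : ∀ j ∈ univ, HasDerivAt (fun s : ℝ => ((x + s • v) j - a j) ^ 2)
        (2 * (x j - a j) * (Pi.single i (1 : ℝ) : Fin n → ℝ) j) 0 := by
      intro j _
      have h1 := ((((hasDerivAt_id (0 : ℝ)).mul_const (v j)).const_add (x j)).sub_const
        (a j)).fun_pow 2
      have e : (2 * (x j - a j) * (Pi.single i (1 : ℝ) : Fin n → ℝ) j) =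
          ((2 : ℕ) : ℝ) * (x j + id 0 * v j - a j) ^ (2 - 1) * (1 * v j) := by
        simp [hv, Pi.single_apply]
      rw [e]
      exact h1
    have h2 := (HasDerivAt.fun_sum h).const_sub (r ^ 2)
    have e : ∑ j, 2 * (x j - a j) * (Pi.single i (1 : ℝ) : Fin n → ℝ) j = 2 * (x i - a i) := by
      simp [Pi.single_apply]
    rw [e] at h2
    exact h2
  have hx0 : x + (0 : ℝ) • v = x := by simp
  have d6 := (((d1.const_mul (t ^ 2)).fun_add ((d4.sub_const t).fun_pow 2)).add_const
    (t ^ 4)).fun_div d5 (by rw [hx0]; exact hw)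
  have hH : DifferentiableAt ℝ (perturbation f a r t) x :=
    (analyticOnNhd_perturbation (U := {x | x ∈ U ∧ r ^ 2 - ∑ j, (x j - a j) ^ 2 ≠ 0})
      (hf.mono fun x hx => hx.1) a r t (fun x hx => hx.2) x ⟨hx, hw⟩).differentiableAt
  have e4 := (hasDerivAt_line hH i).unique d6
  rw [← hv, hx0] at e4
  rw [← hv, hx0] at e3
  rw [e4, map_mul, map_pow, map_pow, eval_ballPolynomial]
  simp only [perturbationNumerator, gradSqNumerator, tangentDeriv, Polynomial.map_add,
    Polynomial.map_mul, Polynomial.map_sub, Polynomial.map_pow, Polynomial.map_C, Polynomial.map_X,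
    Polynomial.eval_add, Polynomial.eval_mul, Polynomial.eval_sub, Polynomial.eval_pow,
    Polynomial.eval_C, Polynomial.eval_X, map_mul, map_sub, map_pow, eval_C, eval_X,
    eval_ballPolynomial, ← hPy, ← e2, eq_neg_of_add_eq_zero_left e1]
  have g1 : graphPoint f x (Fin.last n) = f x := by simp [graphPoint]
  have g2 : graphPoint f x i.castSucc = x i := by simp [graphPoint]
  rw [g1, g2]
  generalize r ^ 2 - ∑ j, (x j - a j) ^ 2 = w at *
  push_cast at e3 ⊢
  field_simp
  linear_combination (t ^ 2 * w * eval (graphPoint f x) Py ^ 2) * e3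

end Perturbation

section BallRelations

open Finset MvPolynomial

variable {n : ℕ} {f : EuclideanSpace ℝ (Fin n) → ℝ} {U : Set (EuclideanSpace ℝ (Fin n))}

theorem analyticOnNhd_eval_graphPoint (hf : AnalyticOnNhd ℝ f U)
    (q : MvPolynomial (Fin (n + 1)) ℝ) :
    AnalyticOnNhd ℝ (fun x => eval (graphPoint f x) q) U := by
  refine AnalyticOnNhd.aeval_mvPolynomial (f := graphPoint f) (fun j => ?_) q
  refine Fin.lastCases ?_ (fun i => ?_) j
  · simpa [graphPoint] using hf
  · simpa [graphPoint] using analyticOnNhd_coord i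

theorem frequently_eval_graphPoint_ne_zero (hconn : IsPreconnected U)
    (hf : AnalyticOnNhd ℝ f U) {q : MvPolynomial (Fin (n + 1)) ℝ}
    (hq : ∃ x ∈ U, eval (graphPoint f x) q ≠ 0) {x : EuclideanSpace ℝ (Fin n)} (hx : x ∈ U) :
    ∃ᶠ y in nhds x, eval (graphPoint f y) q ≠ 0 := by
  intro h
  obtain ⟨z, hz, hqz⟩ := hq
  exact hqz ((analyticOnNhd_eval_graphPoint hf q).eqOn_zero_of_preconnected_of_eventuallyEq_zero
    hconn hx (h.mono fun y hy => not_not.1 hy) hz)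

theorem sum_sq_sub_lt_of_mem_ball {a x : EuclideanSpace ℝ (Fin n)} {r : ℝ}
    (hx : x ∈ Metric.ball a r) : ∑ j, (x j - a j) ^ 2 < r ^ 2 := by
  have h : ∑ j, (x j - a j) ^ 2 = ‖x - a‖ ^ 2 := by simp [EuclideanSpace.norm_sq_eq]
  rw [h]
  rw [mem_ball_iff_norm] at hx
  gcongr

/-- The value of `W` at the parameter `t`, the partial derivatives of the perturbation and the
polynomial `ξ`. -/
noncomputable def relationValue (f : EuclideanSpace ℝ (Fin n) → ℝ)
    (a : EuclideanSpace ℝ (Fin n)) (r : ℝ)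
    (W : MvPolynomial (Fin n) (Polynomial (Polynomial ℝ))) (ξ : MvPolynomial (Fin (n + 1)) ℝ)
    (t : ℝ) (x : EuclideanSpace ℝ (Fin n)) : ℝ :=
  W.eval₂ (Polynomial.eval₂RingHom (Polynomial.evalRingHom t) (eval (graphPoint f x) ξ))
    fun i => partialDeriv (perturbation f a r t) i x

variable {a : EuclideanSpace ℝ (Fin n)} {r : ℝ}

theorem continuousAt_relationValue (hf : AnalyticOnNhd ℝ f U) (hr : Metric.ball a r ⊆ U)
    (W : MvPolynomial (Fin n) (Polynomial (Polynomial ℝ))) (ξ : MvPolynomial (Fin (n + 1)) ℝ)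
    (t : ℝ) {x : EuclideanSpace ℝ (Fin n)} (hx : x ∈ Metric.ball a r) :
    ContinuousAt (relationValue f a r W ξ t) x := by
  have h1 : ContinuousAt (fun x => eval (graphPoint f x) ξ) x :=
    (analyticOnNhd_eval_graphPoint hf ξ x (hr hx)).continuousAt
  have h2 : ∀ i, ContinuousAt (partialDeriv (perturbation f a r t) i) x := fun i =>
    (analyticOnNhd_partialDeriv (analyticOnNhd_perturbation (hf.mono hr) a r t fun y hy =>
      (sub_pos.2 (sum_sq_sub_lt_of_mem_ball hy)).ne') i x hx).continuousAt
  have h3 : ∀ c : Polynomial (Polynomial ℝ), ContinuousAt (fun x =>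
      Polynomial.eval₂RingHom (Polynomial.evalRingHom t) (eval (graphPoint f x) ξ) c) x := by
    intro c
    simp only [Polynomial.coe_eval₂RingHom, ← Polynomial.eval_map]
    exact (Polynomial.continuous _).continuousAt.comp h1
  unfold relationValue
  simp only [eval₂_eq']
  fun_prop

theorem relationValue_eq_zero_of_ne (hconn : IsPreconnected U)
    (hf : AnalyticOnNhd ℝ f U) (hr : Metric.ball a r ⊆ U)
    (W : MvPolynomial (Fin n) (Polynomial (Polynomial ℝ))) (ξ : MvPolynomial (Fin (n + 1)) ℝ)
    (t : ℝ) {q : MvPolynomial (Fin (n + 1)) ℝ} (hq : ∃ x ∈ U, eval (graphPoint f x) q ≠ 0)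
    (h : ∀ x ∈ Metric.ball a r, eval (graphPoint f x) q ≠ 0 → relationValue f a r W ξ t x = 0) :
    ∀ x ∈ Metric.ball a r, relationValue f a r W ξ t x = 0 := by
  intro x hx
  by_contra hne
  have h1 := (continuousAt_relationValue hf hr W ξ t hx).eventually_ne hne
  have h2 := Metric.isOpen_ball.mem_nhds hx
  obtain ⟨y, hy1, hy2, hy3⟩ :=
    ((frequently_eval_graphPoint_ne_zero hconn hf hq (hr hx)).and_eventually
      (h1.and h2)).exists
  exact hy2 (h y hy3 hy1)

variable {Q : MvPolynomial (Fin (n + 1)) ℝ} {d K : ℕ}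

theorem exists_relationValue_eq_zero (hU : IsOpen U) (hconn : IsPreconnected U)
    (hf : AnalyticOnNhd ℝ f U) (hr : Metric.ball a r ⊆ U) (hQ0 : Q ≠ 0)
    (hQ : ∀ x ∈ U, eval (graphPoint f x) Q = 0) (hd : Q.totalDegree ≤ d) (hd1 : 1 ≤ d)
    (hQy : ∃ x ∈ U, eval (graphPoint f x) (pderiv (Fin.last n) Q) ≠ 0)
    (hK : d * (4 * d + 1) ^ n ≤ K) (ξ : MvPolynomial (Fin (n + 1)) ℝ) :
    ∃ W : MvPolynomial (Fin n) (Polynomial (Polynomial ℝ)), W ≠ 0 ∧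
      (∀ e, (W.coeff e).natDegree ≤ K) ∧
      ∀ x ∈ Metric.ball a r, ∀ t, relationValue f a r W ξ t x = 0 := by
  obtain ⟨e, rfl⟩ : ∃ e, d = e + 1 := ⟨d - 1, by omega⟩
  have hs : (ballPolynomial a r ^ 2 * pderiv (Fin.last n) Q ^ 4).totalDegree ≤ 4 * (e + 1) := by
    have h := totalDegree_pderiv_le (Fin.last n) Q
    exact totalDegree_mul_le_add (totalDegree_pow_le_mul (totalDegree_ballPolynomial_le a r) 2)
      (totalDegree_pow_le_mul (b := e) (by omega) 4) (by omega)
  obtain ⟨W, h1, h2, h3⟩ := exists_relation (graphPoint f '' U) hQ0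
    (by rintro _ ⟨x, hx, rfl⟩; exact hQ x hx) hd hd1 hK (perturbationNumerator Q a r)
    (boundedBy_perturbationNumerator hd a r) _ hs ξ
  refine ⟨W, h1, h2, fun x hx t => ?_⟩
  refine relationValue_eq_zero_of_ne hconn hf hr W ξ t hQy (fun x hx hxy => ?_) x hx
  have hw := (sub_pos.2 (sum_sq_sub_lt_of_mem_ball hx)).ne'
  refine h3 _ ⟨x, hr hx, rfl⟩ ?_ t _ fun i =>
    partialDeriv_perturbation_mul hU hf hQ a r t (hr hx) hw i
  rw [map_mul, map_pow, map_pow, eval_ballPolynomial]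
  exact mul_ne_zero (pow_ne_zero _ hw) (pow_ne_zero _ hxy)

/-- A nontrivial relation between `t` and the partial derivatives of the perturbation that holds
wherever `∂Q/∂y` vanishes. -/
theorem exists_relation_of_pderiv_eq_zero (hU : IsOpen U) (hconn : IsPreconnected U)
    (hf : AnalyticOnNhd ℝ f U) (hr : Metric.ball a r ⊆ U) (hQ0 : Q ≠ 0)
    (hQ : ∀ x ∈ U, eval (graphPoint f x) Q = 0)
    (hQy : ∃ x ∈ U, eval (graphPoint f x) (pderiv (Fin.last n) Q) ≠ 0) :
    ∃ N : MvPolynomial (Fin n) (Polynomial ℝ), N ≠ 0 ∧ ∀ x ∈ Metric.ball a r, ∀ t,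
      eval (graphPoint f x) (pderiv (Fin.last n) Q) = 0 →
      N.eval₂ (Polynomial.evalRingHom t) (fun i => partialDeriv (perturbation f a r t) i x)
        = 0 := by
  obtain ⟨W, hW0, -, hW⟩ := exists_relationValue_eq_zero hU hconn hf hr hQ0 hQ
    (Nat.le_succ Q.totalDegree) (by omega) hQy le_rfl (pderiv (Fin.last n) Q)
  have hprime : Prime (C Polynomial.X : MvPolynomial (Fin n) (Polynomial (Polynomial ℝ))) :=
    (prime_C_iff _).2 Polynomial.prime_X
  obtain ⟨k, W', hdvd, hWW'⟩ := WfDvdMonoid.max_power_factor hW0 hprime.irreducible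
  refine ⟨W'.map Polynomial.constantCoeff, fun h => hdvd ?_, fun x hx t hxy => ?_⟩
  · rw [C_dvd_iff_dvd_coeff]
    intro e
    rw [Polynomial.X_dvd_iff]
    have h1 := congrArg (coeff e) h
    rwa [coeff_map, coeff_zero] at h1
  · have h := relationValue_eq_zero_of_ne hconn hf hr W' (pderiv (Fin.last n) Q) t hQy
      (fun y hy hne => ?_) x hx
    · rw [eval₂_map]
      rw [relationValue, hxy] at h
      convert h using 2
      ext p
      all_goals simp [Polynomial.constantCoeff_apply]
    · have h1 := hW y hy t
      rw [relationValue, hWW', eval₂_mul, eval₂_pow, eval₂_C] at h1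
      exact (mul_eq_zero.1 h1).resolve_left (pow_ne_zero _ (by simpa using hne))

/-- A finite family of nonzero polynomials remains nonzero after substituting large enough
powers. -/
theorem exists_powers_eval_ne_zero {R κ : Type*} [CommRing R] [IsDomain R] [Fintype κ]
    (W : κ → MvPolynomial (Fin n) R) (hW : ∀ k, W k ≠ 0) (τ : R)
    (hτ : Function.Injective fun m : ℕ => τ ^ m) (m₀ : ℕ) :
    ∃ M : Fin n → ℕ, (∀ i, m₀ ≤ M i) ∧ ∀ k, eval (fun i => τ ^ M i) (W k) ≠ 0 := by
  by_contra! h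
  have hprod : ∏ k, W k ≠ 0 := prod_ne_zero_iff.2 fun k _ => hW k
  refine hprod (funext_set (fun _ => (fun m : ℕ => τ ^ m) '' Set.Ici m₀) (fun _ =>
    (Set.Ici_infinite m₀).image hτ.injOn) fun x hx => ?_)
  choose M hM hMx using fun i => hx i (Set.mem_univ i)
  obtain ⟨k, hk⟩ := h M hM
  rw [map_zero, map_prod]
  refine prod_eq_zero (mem_univ k) ?_
  rw [← hk]
  congr 2
  ext i
  exact (hMx i).symm

end BallRelations

section Exponents

open MvPolynomial

variable {n : ℕ} {f : EuclideanSpace ℝ (Fin n) → ℝ} {U : Set (EuclideanSpace ℝ (Fin n))}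
  {a : EuclideanSpace ℝ (Fin n)} {r : ℝ} {Q : MvPolynomial (Fin (n + 1)) ℝ} {d K : ℕ}

theorem MvPolynomial.map_eval_eq_eval₂ {σ R S : Type*} [CommSemiring R] [CommSemiring S]
    (φ : R →+* S) (g : σ → R) (p : MvPolynomial σ R) :
    φ (eval g p) = eval₂ φ (fun i => φ (g i)) p := by
  rw [eval, coe_eval₂Hom, eval₂_comp_left]
  rfl

theorem natDegree_eval_powers_le (W : MvPolynomial (Fin n) (Polynomial (Polynomial ℝ)))
    (hW : ∀ e, (W.coeff e).natDegree ≤ K) (c : Fin n → Polynomial ℝ) :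
    (eval (fun i => Polynomial.C (c i)) W).natDegree ≤ K := by
  rw [eval_eq']
  refine Polynomial.natDegree_sum_le_of_forall_le _ _ fun e _ => ?_
  have h : ∏ i, (Polynomial.C (c i)) ^ e i = Polynomial.C (∏ i, c i ^ e i) := by
    simp [map_prod]
  rw [h]
  exact (Polynomial.natDegree_mul_C_le _ _).trans (hW e)

/-- At the points where the partial derivatives of the perturbation are suitable powers of `t`,
the coordinates of the graph are algebraic over `t` of bounded degree, and `∂Q/∂y` does not vanish
unless `t` is one of finitely many values. -/
theorem exists_exponents (hU : IsOpen U) (hconn : IsPreconnected U)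
    (hf : AnalyticOnNhd ℝ f U) (hr : Metric.ball a r ⊆ U) (hQ0 : Q ≠ 0)
    (hQ : ∀ x ∈ U, eval (graphPoint f x) Q = 0) (hd : Q.totalDegree ≤ d) (hd1 : 1 ≤ d)
    (hQy : ∃ x ∈ U, eval (graphPoint f x) (pderiv (Fin.last n) Q) ≠ 0)
    (hK : d * (4 * d + 1) ^ n ≤ K) (m : ℕ) :
    ∃ M : Fin n → ℕ, (∀ i, m ≤ M i) ∧
      (∃ N : Polynomial ℝ, N ≠ 0 ∧ ∀ x ∈ Metric.ball a r, ∀ t,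
        (∀ i, partialDeriv (perturbation f a r t) i x = t ^ M i) →
        eval (graphPoint f x) (pderiv (Fin.last n) Q) = 0 → N.eval t = 0) ∧
      ∀ j, ∃ V : Polynomial (Polynomial ℝ), V ≠ 0 ∧ V.natDegree ≤ K ∧
        ∀ x ∈ Metric.ball a r, ∀ t,
        (∀ i, partialDeriv (perturbation f a r t) i x = t ^ M i) →
        (V.map (Polynomial.evalRingHom t)).eval (graphPoint f x j) = 0 := by
  choose W hW0 hWK hW using fun j : Fin (n + 1) =>
    exists_relationValue_eq_zero hU hconn hf hr hQ0 hQ hd hd1 hQy hK (X j)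
  obtain ⟨N, hN0, hN⟩ := exists_relation_of_pderiv_eq_zero hU hconn hf hr hQ0 hQ hQy
  obtain ⟨M, hM, hMW⟩ := exists_powers_eval_ne_zero
    (fun k : Option (Fin (n + 1)) => k.elim (N.map Polynomial.C) W)
    (fun k => by
      cases k with
      | none => exact (map_ne_zero_iff _ (map_injective _ Polynomial.C_injective)).2 hN0
      | some j => exact hW0 j)
    (Polynomial.C Polynomial.X)
    (fun p q h => by
      simp only [← Polynomial.C_pow] at h
      simpa using congrArg Polynomial.natDegree (Polynomial.C_injective h)) m
  refine ⟨M, hM, ⟨eval (fun i => Polynomial.X ^ M i) N, fun h => hMW none ?_,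
    fun x hx t ht hxy => ?_⟩, fun j => ⟨eval (fun i => (Polynomial.C Polynomial.X) ^ M i) (W j),
    hMW (some j), ?_, fun x hx t ht => ?_⟩⟩
  · have h1 := MvPolynomial.map_eval_eq_eval₂ (Polynomial.C (R := Polynomial ℝ))
      (fun i => Polynomial.X ^ M i) N
    rw [h, map_zero] at h1
    simpa [eval_map] using h1.symm
  · have h1 := MvPolynomial.map_eval_eq_eval₂ (Polynomial.evalRingHom t)
      (fun i => Polynomial.X ^ M i) N
    have h2 := hN x hx t hxy
    simp only [ht] at h2
    simpa [h2] using h1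
  · simpa only [Polynomial.C_pow] using
      natDegree_eval_powers_le (W j) (hWK j) fun i => Polynomial.X ^ M i
  · have h1 := MvPolynomial.map_eval_eq_eval₂
      (Polynomial.eval₂RingHom (Polynomial.evalRingHom t) (graphPoint f x j))
      (fun i => (Polynomial.C Polynomial.X) ^ M i) (W j)
    have h2 := hW j x hx t
    simp only [relationValue, ht, eval_X] at h2
    have h3 : ∀ i, Polynomial.eval₂RingHom (Polynomial.evalRingHom t) (graphPoint f x j)
        (Polynomial.C Polynomial.X ^ M i) = t ^ M i := fun i => by
      rw [map_pow]
      simp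
    simp only [h3] at h1
    rw [Polynomial.eval_map, ← Polynomial.coe_eval₂RingHom, h1, h2]

end Exponents

section Minimiser

open Finset

variable {n : ℕ} {f : EuclideanSpace ℝ (Fin n) → ℝ} {U : Set (EuclideanSpace ℝ (Fin n))}
  {a : EuclideanSpace ℝ (Fin n)} {r : ℝ}

theorem abs_sum_mul_sub_le {x : EuclideanSpace ℝ (Fin n)} (hx : ‖x - a‖ ≤ r) {c : Fin n → ℝ}
    {b : ℝ} (hc : ∀ i, |c i| ≤ b) : |∑ i, c i * (x i - a i)| ≤ n * (b * r) := by
  refine (abs_sum_le_sum_abs _ _).trans ?_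
  have h : ∀ i ∈ univ, |c i * (x i - a i)| ≤ b * r := fun i _ => by
    rw [abs_mul]
    have h1 : |x i - a i| ≤ r := by
      simpa using (PiLp.norm_apply_le (x - a) i).trans hx
    exact mul_le_mul (hc i) h1 (abs_nonneg _) ((abs_nonneg _).trans (hc i))
  simpa using sum_le_card_nsmul _ _ _ h

theorem hasFDerivAt_sum_mul_sub (c : Fin n → ℝ) (x : EuclideanSpace ℝ (Fin n)) :
    HasFDerivAt (fun x : EuclideanSpace ℝ (Fin n) => ∑ i, c i * (x i - a i))
      (∑ i, c i • EuclideanSpace.proj (𝕜 := ℝ) i) x := by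
  refine HasFDerivAt.fun_sum fun i _ => HasFDerivAt.const_mul ?_ (c i)
  exact (EuclideanSpace.proj i : EuclideanSpace ℝ (Fin n) →L[ℝ] ℝ).hasFDerivAt.sub_const (a i)

theorem partialDeriv_eq_of_isLocalMin {g : EuclideanSpace ℝ (Fin n) → ℝ} {c : Fin n → ℝ}
    {x : EuclideanSpace ℝ (Fin n)} (hg : DifferentiableAt ℝ g x)
    (hmin : IsLocalMin (fun x => g x - ∑ i, c i * (x i - a i)) x) (i : Fin n) :
    partialDeriv g i x = c i := by
  have h := hmin.hasFDerivAt_eq_zero (hg.hasFDerivAt.sub (hasFDerivAt_sum_mul_sub c x))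
  have h1 := congrArg (fun L => L (EuclideanSpace.single i (1 : ℝ))) h
  simp [Finset.sum_ite_eq'] at h1
  exact sub_eq_zero.1 h1

theorem exists_partialDeriv_perturbation_eq_pow (hf : AnalyticOnNhd ℝ f U) (hr0 : 0 < r)
    (hr : Metric.ball a r ⊆ U) {M : Fin n → ℕ} (hM : ∀ i, 4 ≤ M i)
    {x₀ : EuclideanSpace ℝ (Fin n)} (hx₀ : ‖x₀ - a‖ ≤ r / 2) {t : ℝ} (ht : f x₀ = t)
    (ht0 : t ≠ 0) (ht1 : |t| ≤ 1) :
    ∃ x ∈ Metric.ball a r, (∀ i, partialDeriv (perturbation f a r t) i x = t ^ M i) ∧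
      t ^ 2 * ∑ j, partialDeriv f j x ^ 2 + (f x - t) ^ 2 ≤
        2 * (t ^ 2 * ∑ j, partialDeriv f j x₀ ^ 2) + (2 + 2 * n * r ^ 3) * t ^ 4 := by
  set A : EuclideanSpace ℝ (Fin n) → ℝ := fun x =>
    t ^ 2 * ∑ j, partialDeriv f j x ^ 2 + (f x - t) ^ 2 + t ^ 4 with hA
  set w : EuclideanSpace ℝ (Fin n) → ℝ := fun x => r ^ 2 - ‖x - a‖ ^ 2 with hw
  set L : EuclideanSpace ℝ (Fin n) → ℝ := fun x => ∑ i, t ^ M i * (x i - a i) with hL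
  have hpert : ∀ x, perturbation f a r t x = A x / w x := fun x => by
    have h : ∑ j, (x j - a j) ^ 2 = ‖x - a‖ ^ 2 := by simp [EuclideanSpace.norm_sq_eq]
    rw [perturbation, h]
  have hLb : ∀ x, ‖x - a‖ ≤ r → |L x| ≤ n * (t ^ 4 * r) := fun x hx =>
    abs_sum_mul_sub_le hx fun i => by
      rw [abs_pow, ← Even.pow_abs ⟨2, rfl⟩ t]
      exact pow_le_pow_of_le_one (abs_nonneg t) ht1 (hM i)
  have ht4 : 0 < t ^ 4 := by positivity
  have hA4 : ∀ x, t ^ 4 ≤ A x := fun x => by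
    simp only [hA]
    have : 0 ≤ t ^ 2 * ∑ j, partialDeriv f j x ^ 2 + (f x - t) ^ 2 := by positivity
    linarith
  set B : ℝ := |A x₀ / w x₀ - L x₀ + n * (t ^ 4 * r)| + 1
  have hB : 0 < B := by positivity
  set η : ℝ := min (r ^ 2 / 2) (t ^ 4 / B)
  have hη0 : 0 < η := by positivity
  have hη1 : η ≤ r ^ 2 / 2 := min_le_left _ _
  have hη2 : η ≤ t ^ 4 / B := min_le_right _ _
  have hρ2 : √(r ^ 2 - η) ^ 2 = r ^ 2 - η := Real.sq_sqrt (by nlinarith)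
  set ρ : ℝ := √(r ^ 2 - η)
  have hρ0 : 0 ≤ ρ := Real.sqrt_nonneg _
  have hρr : ρ < r := by
    refine lt_of_pow_lt_pow_left₀ 2 hr0.le ?_
    linarith
  have hρr2 : r / 2 ≤ ρ := by
    refine le_of_sq_le_sq ?_ hρ0
    nlinarith
  have hsub : Metric.closedBall a ρ ⊆ Metric.ball a r := Metric.closedBall_subset_ball hρr
  have han := analyticOnNhd_perturbation (hf.mono hr) a r t fun y hy =>
    (sub_pos.2 (sum_sq_sub_lt_of_mem_ball hy)).ne'
  have hLd : ∀ x, DifferentiableAt ℝ L x := fun x =>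
    (hasFDerivAt_sum_mul_sub (fun i => t ^ M i) x).differentiableAt
  have hcont : ContinuousOn (fun x => perturbation f a r t x - L x) (Metric.closedBall a ρ) :=
    fun x hx => ((han x (hsub hx)).continuousAt.sub (hLd x).continuousAt).continuousWithinAt
  have hx₀ρ : x₀ ∈ Metric.closedBall a ρ := by
    rw [mem_closedBall_iff_norm]
    exact hx₀.trans hρr2
  obtain ⟨x, hx, hmin⟩ := (isCompact_closedBall a ρ).exists_isMinOn ⟨x₀, hx₀ρ⟩ hcont
  have hle : A x / w x - L x ≤ A x₀ / w x₀ - L x₀ := by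
    simpa only [hpert] using isMinOn_iff.1 hmin x₀ hx₀ρ
  have hxr : ‖x - a‖ < r := mem_ball_iff_norm.1 (hsub hx)
  have hwx : 0 < w x := sub_pos.2 (by gcongr)
  have hLx := abs_le.1 (hLb x hxr.le)
  have hLx₀ := abs_le.1 (hLb x₀ (by linarith))
  have hxρ : ‖x - a‖ < ρ := by
    refine lt_of_le_of_ne (mem_closedBall_iff_norm.1 hx) fun h => ?_
    have hwη : w x = η := by
      simp only [hw, h]
      linarith
    have h1 : B ≤ A x / w x := by
      rw [hwη, le_div_iff₀ hη0]
      rw [le_div_iff₀ hB] at hη2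
      linarith [hA4 x]
    have h2 := le_abs_self (A x₀ / w x₀ - L x₀ + n * (t ^ 4 * r))
    have h3 : B = |A x₀ / w x₀ - L x₀ + n * (t ^ 4 * r)| + 1 := rfl
    linarith
  refine ⟨x, hsub hx, fun i => ?_, ?_⟩
  · refine partialDeriv_eq_of_isLocalMin (a := a) (c := fun i => t ^ M i)
      (han x (hsub hx)).differentiableAt ?_ i
    exact hmin.isLocalMin (Filter.mem_of_superset
      (Metric.isOpen_ball.mem_nhds (mem_ball_iff_norm.2 hxρ)) Metric.ball_subset_closedBall)
  · have hw₀ : 3 / 4 * r ^ 2 ≤ w x₀ := by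
      have : ‖x₀ - a‖ ^ 2 ≤ (r / 2) ^ 2 := by gcongr
      simp only [hw]
      linarith
    have hwr : w x ≤ r ^ 2 := sub_le_self _ (by positivity)
    have hA₀ : A x₀ = t ^ 2 * ∑ j, partialDeriv f j x₀ ^ 2 + t ^ 4 := by simp [hA, ht]
    have hA₀0 : 0 ≤ A x₀ := ht4.le.trans (hA4 x₀)
    have h1 : A x / w x ≤ A x₀ / (3 / 4 * r ^ 2) + 2 * (n * (t ^ 4 * r)) := by
      have : A x₀ / w x₀ ≤ A x₀ / (3 / 4 * r ^ 2) := by gcongr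
      linarith
    rw [div_le_iff₀ hwx] at h1
    have h2 : A x ≤ (A x₀ / (3 / 4 * r ^ 2) + 2 * (n * (t ^ 4 * r))) * r ^ 2 :=
      h1.trans (by gcongr)
    have h3 : (A x₀ / (3 / 4 * r ^ 2) + 2 * (n * (t ^ 4 * r))) * r ^ 2 =
        4 / 3 * A x₀ + 2 * n * r ^ 3 * t ^ 4 := by
      field_simp
    have h4 : A x = t ^ 2 * ∑ j, partialDeriv f j x ^ 2 + (f x - t) ^ 2 + t ^ 4 := rfl
    have h5 : 0 ≤ t ^ 2 * ∑ j, partialDeriv f j x₀ ^ 2 := by positivity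
    linarith

end Minimiser

open Filter Topology

theorem tendsto_pow_div_pow_of_sq_le {S s : ℕ} (hS : S = 2 * s) (hs : s ≠ 0) {t φ G δ : ℕ → ℝ}
    {c : ℝ} (ht0 : ∀ k, t k ≠ 0) (ht : Tendsto t atTop (𝓝 0))
    (hδ : Tendsto δ atTop (𝓝 0)) (hG : ∀ k, G k ≤ (δ k * |t k| ^ (1 - 1 / (S : ℝ))) ^ 2)
    (hφ : ∀ k, φ k ^ 2 ≤ 2 * G k + c * t k ^ 2) :
    Tendsto (fun k => φ k ^ S / t k ^ (S - 1)) atTop (𝓝 0) := by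
  have hS0 : (S : ℝ) ≠ 0 := by
    rw [hS]
    positivity
  have htabs : Tendsto (fun k => |t k|) atTop (𝓝 0) := by simpa using ht.abs
  have hroot : Tendsto (fun k => |t k| ^ (1 / (S : ℝ))) atTop (𝓝 0) := by
    have h : 0 < 1 / (S : ℝ) := by positivity
    have h1 := htabs.rpow_const (p := 1 / (S : ℝ)) (Or.inr h.le)
    rwa [Real.zero_rpow h.ne'] at h1
  have hlim : Tendsto (fun k => (2 * δ k ^ 2 + c * (|t k| ^ (1 / (S : ℝ))) ^ 2) ^ s) atTop
      (𝓝 0) := by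
    have h := (((hδ.pow 2).const_mul 2).add ((hroot.pow 2).const_mul c)).pow s
    simpa [hs] using h
  refine squeeze_zero_norm (fun k => ?_) hlim
  have ht' : 0 < |t k| := abs_pos.2 (ht0 k)
  set u : ℝ := |t k| ^ (1 - 1 / (S : ℝ)) with hu
  have hu0 : 0 < u := Real.rpow_pos_of_pos ht' _
  have huS : u ^ S = |t k| ^ (S - 1) := by
    rw [hu, ← Real.rpow_natCast, ← Real.rpow_mul ht'.le, ← Real.rpow_natCast,
      Nat.cast_sub (by omega)]
    congr 1
    field_simp
    simp
  have htu : |t k| = |t k| ^ (1 / (S : ℝ)) * u := by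
    rw [hu, ← Real.rpow_add ht']
    simp
  have h1 : φ k ^ 2 / u ^ 2 ≤ 2 * δ k ^ 2 + c * (|t k| ^ (1 / (S : ℝ))) ^ 2 := by
    rw [div_le_iff₀ (by positivity)]
    have h2 : t k ^ 2 = (|t k| ^ (1 / (S : ℝ))) ^ 2 * u ^ 2 := by
      rw [← sq_abs (t k), ← mul_pow, ← htu]
    have h3 := hφ k
    have h4 := hG k
    rw [h2] at h3
    nlinarith
  have h5 : ‖φ k ^ S / t k ^ (S - 1)‖ = (φ k ^ 2 / u ^ 2) ^ s := by
    rw [norm_div, norm_pow, norm_pow, Real.norm_eq_abs, Real.norm_eq_abs, ← huS, hS, pow_mul,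
      pow_mul, sq_abs, div_pow]
  rw [h5]
  gcongr

theorem mul_pow_le_two_mul_pow {d : ℕ} (hd : 2 ≤ d) (n : ℕ) :
    d * (4 * d + 1) ^ n ≤ 2 * (2 * d - 1) ^ (3 * n + 1) := by
  have h1 : 4 * d + 1 ≤ (2 * d - 1) ^ 3 := by
    obtain ⟨e, rfl⟩ := Nat.exists_eq_add_of_le hd
    have : 2 * (2 + e) - 1 = 2 * e + 3 := by omega
    rw [this]
    nlinarith [Nat.zero_le (e ^ 3), Nat.zero_le (e ^ 2), Nat.zero_le e]
  calc d * (4 * d + 1) ^ n ≤ (2 * (2 * d - 1)) * ((2 * d - 1) ^ 3) ^ n := by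
        gcongr
        omega
    _ = _ := by ring

theorem stmt_1 (n : ℕ) (U : Set (EuclideanSpace ℝ (Fin n))) (hUopen : IsOpen U)
    (hUconn : IsConnected U) (a : EuclideanSpace ℝ (Fin n)) (haU : a ∈ U)
    (f : EuclideanSpace ℝ (Fin n) → ℝ) (hf : AnalyticOnNhd ℝ f U)
    (hfne : ∃ x ∈ U, f x ≠ 0) (hfa : f a = 0) (hgrad : gradient f a = 0)
    (P : MvPolynomial (Fin (n + 1)) ℝ) (hPirr : Irreducible P)
    (hPf : ∀ x ∈ U, MvPolynomial.eval (Fin.snoc (fun i => x i) (f x)) P = 0)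
    (d : ℕ) (hd : d = P.totalDegree) :
    ∃ C > 0, ∃ ε > 0, ∀ x ∈ U, ‖x - a‖ < ε → |f x| < ε →
      ‖gradient f x‖ ≥ C * |f x| ^
        (1 - 1 / ((2 * (2 * d - 1) ^ (3 * n + 1) : ℕ) : ℝ)) := by
  have hd2 : 2 ≤ d := hd ▸ two_le_totalDegree hUopen hUconn.isPreconnected haU hf hfne hfa
    (fun i => by rw [← gradient_apply_eq_partialDeriv, hgrad]; rfl) P hPirr.ne_zero hPf
  obtain ⟨Q, hQ0, hQd, hQ, hQy⟩ :=
    exists_polynomial_pderiv_ne_zero hUopen ⟨a, haU⟩ hf P hPirr.ne_zero hPf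
  obtain ⟨r, hr0, hr⟩ := Metric.isOpen_iff.1 hUopen a haU
  have hs : (2 * d - 1) ^ (3 * n + 1) ≠ 0 := pow_ne_zero _ (by omega)
  have hK := mul_pow_le_two_mul_pow hd2 n
  generalize hSdef : 2 * (2 * d - 1) ^ (3 * n + 1) = S at hK ⊢
  have hS2 : 2 ≤ S := by omega
  have hp : 1 - 1 / (S : ℝ) ≠ 0 := by
    have : (2 : ℝ) ≤ S := by exact_mod_cast hS2
    rw [sub_ne_zero, ne_comm]
    exact ((div_lt_one (by linarith)).2 (by linarith)).ne
  obtain ⟨M, hM, ⟨N, hN0, hN⟩, hV⟩ := exists_exponents hUopen hUconn.isPreconnected hf hr hQ0 hQ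
    (hQd.trans hd.ge) (by omega) hQy hK 4
  by_contra! hcon
  have hδ0 : ∀ k : ℕ, (0 : ℝ) < 1 / ((k : ℝ) + 1) := fun k => by positivity
  have hδ : Tendsto (fun k : ℕ => 1 / ((k : ℝ) + 1)) atTop (𝓝 0) :=
    tendsto_one_div_add_atTop_nhds_zero_nat
  choose x₀ hx₀U hx₀a hx₀f hx₀g using fun k : ℕ =>
    hcon _ (hδ0 k) (min (r / 2) (1 / ((k : ℝ) + 1))) (lt_min (by positivity) (hδ0 k))
  have ht0 : ∀ k, f (x₀ k) ≠ 0 := fun k h => by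
    have h1 := hx₀g k
    rw [h, abs_zero, Real.zero_rpow hp, mul_zero] at h1
    exact (norm_nonneg _).not_gt h1
  have hfδ : ∀ k, |f (x₀ k)| ≤ 1 / ((k : ℝ) + 1) := fun k =>
    (hx₀f k).le.trans (min_le_right _ _)
  choose x hx hxt hxf using fun k => exists_partialDeriv_perturbation_eq_pow hf hr0 hr hM
    ((hx₀a k).le.trans (min_le_left _ _)) rfl (ht0 k)
    ((hfδ k).trans ((div_le_one (by positivity)).2 (by simp)))
  have ht : Tendsto (fun k => f (x₀ k)) atTop (𝓝 0) := squeeze_zero_norm hfδ hδ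
  set c : ℝ := 2 + 2 * n * r ^ 3
  set G : ℕ → ℝ := fun k => ∑ j, partialDeriv f j (x₀ k) ^ 2
  have hG : ∀ k, G k ≤ (1 / ((k : ℝ) + 1) * |f (x₀ k)| ^ (1 - 1 / (S : ℝ))) ^ 2 := fun k => by
    have h := (hx₀g k).le
    simp only [G, ← norm_gradient_sq]
    gcongr
  have hG1 : ∀ k, G k ≤ (1 / ((k : ℝ) + 1)) ^ 2 := fun k => by
    refine (hG k).trans ?_
    have h1 : |f (x₀ k)| ^ (1 - 1 / (S : ℝ)) ≤ 1 := by
      refine Real.rpow_le_one (abs_nonneg _) ((hfδ k).trans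
        ((div_le_one (by positivity)).2 (by simp))) ?_
      rw [sub_nonneg]
      exact (div_le_one (by positivity)).2 (by exact_mod_cast hS2.trans' one_le_two)
    have h2 := hδ0 k
    gcongr
    exact mul_le_of_le_one_right h2.le h1
  have hbound : ∀ k, ∑ j, partialDeriv f j (x k) ^ 2 + (f (x k) / f (x₀ k) - 1) ^ 2 ≤
      2 * G k + c * f (x₀ k) ^ 2 := fun k => by
    have ht2 : 0 < f (x₀ k) ^ 2 := by
      have := ht0 k
      positivity
    refine le_of_mul_le_mul_left (le_of_eq_of_le ?_ ((hxf k).trans_eq ?_)) ht2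
    · have := ht0 k
      field_simp
    · ring
  refine false_of_sequences (n := n) (S := S) (by omega) (fun k => f (x₀ k)) (fun k => f (x k))
    (fun i k => x k i) (fun i k => partialDeriv f i (x k)) (Eventually.of_forall ht0) ht
    (‖a‖ + r) ?_ ?_ ?_ ?_ ?_ Q ?_ ?_ ?_
  · intro i k
    have h1 : ‖x k i‖ ≤ ‖x k‖ := PiLp.norm_apply_le (x k) i
    have h2 := mem_ball_iff_norm.1 (hx k)
    have h3 := norm_sub_norm_le (x k) a
    rw [Real.norm_eq_abs] at h1
    linarith
  · intro i
    obtain ⟨V, hV0, hVS, hV⟩ := hV i.castSucc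
    refine ⟨V, hV0, hVS, Eventually.of_forall fun k => ?_⟩
    simpa [graphPoint] using hV (x k) (hx k) _ (hxt k)
  · obtain ⟨V, hV0, -, hV⟩ := hV (Fin.last n)
    refine ⟨V, hV0, Eventually.of_forall fun k => ?_⟩
    simpa [graphPoint] using hV (x k) (hx k) _ (hxt k)
  · have hlim : Tendsto (fun k : ℕ => 2 * (1 / ((k : ℝ) + 1)) ^ 2 + c * f (x₀ k) ^ 2) atTop
        (𝓝 0) := by
      simpa using ((hδ.pow 2).const_mul 2).add ((ht.pow 2).const_mul c)
    have hsq : Tendsto (fun k => (f (x k) / f (x₀ k) - 1) ^ 2) atTop (𝓝 0) := by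
      refine squeeze_zero (fun k => sq_nonneg _) (fun k => ?_) hlim
      have h1 : 0 ≤ ∑ j, partialDeriv f j (x k) ^ 2 := by positivity
      linarith [hbound k, hG1 k]
    have habs : Tendsto (fun k => |f (x k) / f (x₀ k) - 1|) atTop (𝓝 0) := by
      simpa [Real.sqrt_sq_eq_abs] using hsq.sqrt
    simpa using ((tendsto_zero_iff_abs_tendsto_zero _).2 habs).add_const 1
  · intro i
    refine tendsto_pow_div_pow_of_sq_le (c := c) hSdef.symm hs ht0 ht hδ hG fun k => ?_
    have h1 : partialDeriv f i (x k) ^ 2 ≤ ∑ j, partialDeriv f j (x k) ^ 2 :=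
      Finset.single_le_sum (f := fun j => partialDeriv f j (x k) ^ 2)
        (fun j _ => sq_nonneg _) (Finset.mem_univ i)
    linarith [hbound k, sq_nonneg (f (x k) / f (x₀ k) - 1)]
  · exact Eventually.of_forall fun k => hQ _ (hr (hx k))
  · have h : Tendsto (fun k => f (x₀ k)) atTop (𝓝[≠] 0) :=
      tendsto_nhdsWithin_iff.2 ⟨ht, Eventually.of_forall ht0⟩
    have hroots : ∀ᶠ τ in 𝓝[≠] (0 : ℝ), N.eval τ ≠ 0 := by
      have hfin := (Polynomial.finite_setOfPred_isRoot hN0).subset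
        (Set.sdiff_subset (t := {(0 : ℝ)}))
      filter_upwards [mem_nhdsWithin_of_mem_nhds (hfin.isClosed.isOpen_compl.mem_nhds (by simp)),
        self_mem_nhdsWithin] with τ h1 h2 h3
      exact h1 ⟨h3, h2⟩
    exact (h.eventually hroots).mono fun k hk h0 => hk (hN _ (hx k) _ (hxt k) h0)
  · exact fun i => Eventually.of_forall fun k =>
      pderiv_add_pderiv_mul_eq_zero hUopen hf hQ (hr (hx k)) i
end

section
/- Let U ⊆ ℝ be an open connected neighbourhood of a point a ∈ ℝ and let f : U → ℝ be a real-analytic function, not identically zero, with f(a) = 0. Let P ∈ ℝ[x, y] be an irreducible polynomial in two variables such that P(x, f(x)) = 0 for all x ∈ U, and let d = deg P. Then there exist constants C > 0 and ε > 0 such that |f′(x)| ≥ C·|f(x)|^(1 − 1/d) for every x ∈ U with |x − a| < ε. -/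
open Filter Topology

/-- The restriction of a bivariate polynomial `P(x, y)` to the line `y = 0` agrees with `P` up to a
multiple of `y`. -/
theorem MvPolynomial.exists_eq_aeval_X_zero_add_X_one_mul {R : Type*} [CommRing R]
    (P : MvPolynomial (Fin 2) R) :
    ∃ Q : MvPolynomial (Fin 2) R,
      P = Polynomial.aeval (X 0) (aeval ![Polynomial.X, 0] P : Polynomial R) + X 1 * Q := by
  induction P using MvPolynomial.induction_on with
  | C r => exact ⟨0, by simp [MvPolynomial.algebraMap_eq]⟩
  | add p q hp hq =>
    obtain ⟨s, hs⟩ := hp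
    obtain ⟨t, ht⟩ := hq
    refine ⟨s + t, ?_⟩
    rw [map_add, map_add]
    linear_combination hs + ht
  | mul_X p i hp =>
    obtain ⟨s, hs⟩ := hp
    fin_cases i
    · refine ⟨s * X 0, ?_⟩
      simp only [Fin.zero_eta, map_mul, aeval_X, Matrix.cons_val_zero, Polynomial.aeval_X]
      linear_combination (X 0) * hs
    · refine ⟨p, ?_⟩
      simp [mul_comm]

/-- The order of vanishing of a nonzero polynomial function is at most its degree. -/
theorem Polynomial.analyticOrderAt_eval_le_natDegree {𝕜 : Type*} [NontriviallyNormedField 𝕜]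
    {p : Polynomial 𝕜} (hp : p ≠ 0) (a : 𝕜) :
    analyticOrderAt (fun x ↦ p.eval x) a ≤ p.natDegree := by
  classical
  have hpan : AnalyticAt 𝕜 (fun x ↦ p.eval x) a := AnalyticOnNhd.eval_polynomial p a trivial
  obtain ⟨q, hq, hdvd⟩ := p.exists_eq_pow_rootMultiplicity_mul_and_not_dvd hp a
  have horder : analyticOrderAt (fun x ↦ p.eval x) a = p.rootMultiplicity a := by
    refine hpan.analyticOrderAt_eq_natCast.2
      ⟨fun x ↦ q.eval x, AnalyticOnNhd.eval_polynomial q a trivial, ?_, .of_forall fun x ↦ ?_⟩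
    · rwa [Ne, ← Polynomial.IsRoot.def, ← Polynomial.dvd_iff_isRoot]
    · conv_lhs => rw [hq]
      simp
  rw [horder]
  exact_mod_cast (Polynomial.count_roots p).symm.trans_le
    ((Multiset.count_le_card a p.roots).trans p.card_roots')

/-- A function vanishing to order `k + 1` satisfies the Łojasiewicz gradient inequality with every
exponent `1 - 1 / d`, `k + 1 ≤ d`. -/
theorem AnalyticAt.exists_mul_rpow_le_abs_deriv {f : ℝ → ℝ} {a : ℝ} (hf : AnalyticAt ℝ f a)
    {k d : ℕ} (hk : analyticOrderAt f a = k + 1) (hkd : k + 1 ≤ d) :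
    ∃ C > 0, ∀ᶠ x in 𝓝 a, C * |f x| ^ (1 - 1 / (d : ℝ)) ≤ |deriv f x| := by
  obtain ⟨g, hg, -, hfg⟩ := (hf.analyticOrderAt_eq_natCast (n := k + 1)).1 (by exact_mod_cast hk)
  obtain ⟨h, hh, hha, hfh⟩ :=
    hf.deriv.analyticOrderAt_eq_natCast.1 (analyticOrderAt_deriv_of_pos hf hk)
  set M : ℝ := |g a| + 1 with hM
  set m : ℝ := |h a| / 2
  have hMpos : 0 < M := by positivity
  have hmpos : 0 < m := by positivity
  have hdpos : (0 : ℝ) < d := by exact_mod_cast (Nat.succ_pos k).trans_le hkd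
  have hd1 : (1 : ℝ) ≤ d := by exact_mod_cast (Nat.le_add_left 1 k).trans hkd
  set s : ℝ := 1 - 1 / (d : ℝ) with hs
  have hs0 : 0 ≤ s := by
    rw [hs, sub_nonneg]
    exact (div_le_one hdpos).2 hd1
  have hks : (k : ℝ) ≤ ((k + 1 : ℕ) : ℝ) * s := by
    have : ((k + 1 : ℕ) : ℝ) / d ≤ 1 := (div_le_one hdpos).2 (by exact_mod_cast hkd)
    calc (k : ℝ) = ((k + 1 : ℕ) : ℝ) - 1 := by push_cast; ring
      _ ≤ ((k + 1 : ℕ) : ℝ) - ((k + 1 : ℕ) : ℝ) / d := by linarith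
      _ = ((k + 1 : ℕ) : ℝ) * s := by rw [hs]; ring
  have hgM : ∀ᶠ x in 𝓝 a, |g x| < M :=
    hg.continuousAt.abs.eventually_lt continuousAt_const (by simp [hM])
  have hhm : ∀ᶠ x in 𝓝 a, m < |h x| :=
    continuousAt_const.eventually_lt hh.continuousAt.abs (half_lt_self (abs_pos.2 hha))
  have hx1 : ∀ᶠ x in 𝓝 a, |x - a| < 1 :=
    (by fun_prop : ContinuousAt (fun x ↦ |x - a|) a).eventually_lt continuousAt_const (by simp)
  refine ⟨m / M ^ s, by positivity, ?_⟩
  filter_upwards [hfg, hfh, hgM, hhm, hx1] with x hfx hdx hgx hhx hx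
  have hpow : (|x - a| ^ (k + 1)) ^ s ≤ |x - a| ^ k := by
    rw [← Real.rpow_natCast, ← Real.rpow_natCast, ← Real.rpow_mul (abs_nonneg _)]
    exact Real.rpow_le_rpow_of_exponent_ge' (abs_nonneg _) hx.le (Nat.cast_nonneg k) hks
  rw [hfx, hdx, smul_eq_mul, smul_eq_mul, abs_mul, abs_mul, abs_pow, abs_pow,
    Real.mul_rpow (by positivity) (abs_nonneg _)]
  calc m / M ^ s * ((|x - a| ^ (k + 1)) ^ s * |g x| ^ s)
      ≤ m / M ^ s * (|x - a| ^ k * M ^ s) := by gcongr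
    _ = |x - a| ^ k * m := by field_simp
    _ ≤ |x - a| ^ k * |h x| := by gcongr

/-- A nonzero analytic function annihilated by an irreducible bivariate polynomial vanishes at each
point to order at most the degree of that polynomial. -/
theorem AnalyticAt.analyticOrderAt_le_totalDegree {f : ℝ → ℝ} {a : ℝ} (hf : AnalyticAt ℝ f a)
    (hftop : analyticOrderAt f a ≠ ⊤) {P : MvPolynomial (Fin 2) ℝ} (hP : Irreducible P)
    (hPf : ∀ᶠ x in 𝓝 a, MvPolynomial.eval ![x, f x] P = 0) :
    analyticOrderAt f a ≤ P.totalDegree := by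
  obtain ⟨Q, hQ⟩ := P.exists_eq_aeval_X_zero_add_X_one_mul
  set p : Polynomial ℝ := MvPolynomial.aeval ![Polynomial.X, 0] P
  have heval (x : ℝ) : MvPolynomial.eval ![x, f x] P =
      p.eval x + f x * MvPolynomial.eval ![x, f x] Q := by
    conv_lhs => rw [hQ]
    rw [map_add, map_mul, MvPolynomial.eval_X, ← MvPolynomial.coe_aeval_eq_eval,
      RingHom.coe_coe, ← Polynomial.aeval_algHom_apply]
    simp
  have hp0 : p ≠ 0 := by
    intro h0
    rw [h0, map_zero, zero_add] at hQ
    have hX : ¬ IsUnit (MvPolynomial.X 1 : MvPolynomial (Fin 2) ℝ) := fun h ↦ by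
      simpa using h.map (MvPolynomial.eval (0 : Fin 2 → ℝ))
    have hQu : IsUnit Q := (hP.isUnit_or_isUnit hQ).resolve_left hX
    refine hftop (analyticOrderAt_eq_top.2 (hPf.mono fun x hx ↦ ?_))
    rw [heval, h0, Polynomial.eval_zero, zero_add] at hx
    exact (mul_eq_zero.1 hx).resolve_right (hQu.map (MvPolynomial.eval ![x, f x])).ne_zero
  have hQan : AnalyticAt ℝ (fun x ↦ MvPolynomial.eval ![x, f x] Q) a := by
    simpa using AnalyticAt.aeval_mvPolynomial (f := fun x ↦ ![x, f x]) (z := a)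
      (by rw [Fin.forall_fin_two]; exact ⟨analyticAt_id, hf⟩) Q
  have hcongr : (fun x ↦ p.eval x) =ᶠ[𝓝 a] f * -fun x ↦ MvPolynomial.eval ![x, f x] Q := by
    filter_upwards [hPf] with x hx
    rw [heval] at hx
    simp only [Pi.mul_apply, Pi.neg_apply]
    linarith
  have hdeg : p.natDegree ≤ P.totalDegree := by
    simpa using MvPolynomial.aeval_natDegree_le (n := 1) P le_rfl ![Polynomial.X, 0]
      (by simp [Fin.forall_fin_two])
  calc analyticOrderAt f a
      ≤ analyticOrderAt (fun x ↦ p.eval x) a := by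
        rw [analyticOrderAt_congr hcongr, analyticOrderAt_mul hf hQan.neg]
        exact le_self_add
    _ ≤ p.natDegree := Polynomial.analyticOrderAt_eval_le_natDegree hp0 a
    _ ≤ P.totalDegree := by exact_mod_cast hdeg

theorem stmt_2 (U : Set ℝ) (hUopen : IsOpen U) (hUconn : IsConnected U)
    (a : ℝ) (haU : a ∈ U) (f : ℝ → ℝ) (hf : AnalyticOnNhd ℝ f U)
    (hfne : ∃ x ∈ U, f x ≠ 0) (hfa : f a = 0)
    (P : MvPolynomial (Fin 2) ℝ) (hPirr : Irreducible P)
    (hPf : ∀ x ∈ U, MvPolynomial.eval ![x, f x] P = 0)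
    (d : ℕ) (hd : d = P.totalDegree) :
    ∃ C > 0, ∃ ε > 0, ∀ x ∈ U, |x - a| < ε →
      |deriv f x| ≥ C * |f x| ^ (1 - 1 / (d : ℝ)) := by
  have hfan := hf a haU
  have hftop : analyticOrderAt f a ≠ ⊤ := by
    intro htop
    obtain ⟨x, hxU, hx⟩ := hfne
    exact hx (hf.eqOn_zero_of_preconnected_of_eventuallyEq_zero hUconn.isPreconnected haU
      (analyticOrderAt_eq_top.1 htop) hxU)
  have hle := hfan.analyticOrderAt_le_totalDegree hftop hPirr
    (eventually_of_mem (hUopen.mem_nhds haU) hPf)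
  obtain ⟨n, hn⟩ := ENat.ne_top_iff_exists.1 hftop
  have hn0 : n ≠ 0 := by
    rintro rfl
    exact hfan.analyticOrderAt_ne_zero.2 hfa (by simpa using hn.symm)
  obtain ⟨k, rfl⟩ := Nat.exists_eq_succ_of_ne_zero hn0
  rw [← hn, ← hd] at hle
  obtain ⟨C, hC, hev⟩ := hfan.exists_mul_rpow_le_abs_deriv (k := k) (d := d)
    (by rw [← hn]; simp) (by exact_mod_cast hle)
  obtain ⟨ε, hε, hball⟩ := Metric.eventually_nhds_iff.1 hev
  exact ⟨C, hC, ε, hε, fun x _ hx ↦ hball (by rwa [Real.dist_eq])⟩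
end
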